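/- Let $d \ge 3$, let $T$ be the $d$-regular tree, and let $A=\mathrm{Aut}(T)$ be its automorphism group with the topology of pointwise convergence on vertices, which makes $A$ a locally compact group. Let $\mu$ be the Haar measure on (the Borel $\sigma$-algebra of) $A$, normalized so that vertex stabilizers have measure $1$. Say that a subgroup of $A$ acts almost freely on $T$ if each of its nontrivial elements fixes only finitely many vertices of $T$. Let $\Gamma \le A$ be a countable subgroup acting almost freely on $T$. Then for $\mu$-almost every $\gamma\in A$, the subgroup $\langle\Gamma,\gamma\rangle$ generated by $\Gamma$ and $\gamma$ acts almost freely on $T$ and is isomorphic to the free product $\Gamma * \mathbb{Z}$, via the homomorphism $\Gamma * \mathbb{Z}\to\langle\Gamma,\gamma\rangle$ that is the identity on $\Gamma$ and sends the generator of $\mathbb{Z}$ to $\gamma$. -/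

import Mathlib

namespace TreeAut

variable {V : Type*}

/-- The topology of pointwise convergence on vertices on `Aut(T)`: the topology induced from the
product topology on `V → V`, where the vertex set `V` is discrete. -/
instance autTopology (T : SimpleGraph V) : TopologicalSpace (T ≃g T) :=
  TopologicalSpace.induced (fun a : T ≃g T => (a : V → V))
    (@Pi.topologicalSpace V (fun _ => V) (fun _ => ⊥))

/-- A subgroup of `Aut(T)` acts almost freely if each of its nontrivial elements fixes only
finitely many vertices. -/
def ActsAlmostFreely (T : SimpleGraph V) (Γ : Subgroup (T ≃g T)) : Prop :=
  ∀ γ ∈ Γ, γ ≠ 1 → {v : V | γ v = v}.Finite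

end TreeAut

open MeasureTheory
open scoped ENNReal

set_option linter.unusedSectionVars false

namespace TreeAut

section Geometry

variable {V : Type*} {T : SimpleGraph V}

lemma dist_map (hT : T.IsTree) (g : T ≃g T) (u v : V) : T.dist (g u) (g v) = T.dist u v := by
  have key : ∀ (g : T ≃g T) (u v : V), T.dist (g u) (g v) ≤ T.dist u v := by
    intro g u v
    obtain ⟨p, hp⟩ := hT.connected.exists_walk_length_eq_dist u v
    have := T.dist_le (p.map g.toHom)
    rw [SimpleGraph.Walk.length_map, hp] at this
    exact this
  refine le_antisymm (key g u v) ?_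
  have := key g.symm (g u) (g v)
  simpa using this

lemma exists_adj_dist (hT : T.IsTree) {u v : V} (h : u ≠ v) :
    ∃ p, T.Adj v p ∧ T.dist u v = T.dist u p + 1 := by
  obtain ⟨p, hp⟩ := hT.connected.exists_walk_length_eq_dist v u
  cases p with
  | nil => exact absurd rfl h
  | @cons _ w _ hadj q =>
    refine ⟨w, hadj, ?_⟩
    have h1 := T.dist_le q
    have h2 := hT.connected.dist_triangle (u := u) (v := w) (w := v)
    have h3 : T.dist w v = 1 := SimpleGraph.dist_eq_one_iff_adj.2 hadj.symm
    rw [SimpleGraph.Walk.length_cons] at hp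
    rw [SimpleGraph.dist_comm] at hp h1
    omega

lemma adj_dist_unique (hT : T.IsTree) {u v p q : V} (hp : T.Adj v p) (hq : T.Adj v q)
    (hp' : T.dist u v = T.dist u p + 1) (hq' : T.dist u v = T.dist u q + 1) : p = q := by
  obtain ⟨a, ha⟩ := hT.connected.exists_walk_length_eq_dist u p
  obtain ⟨b, hb⟩ := hT.connected.exists_walk_length_eq_dist u q
  have h1 : (a.concat hp.symm).IsPath :=
    SimpleGraph.Walk.isPath_of_length_eq_dist _ (by rw [SimpleGraph.Walk.length_concat]; omega)
  have h2 : (b.concat hq.symm).IsPath :=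
    SimpleGraph.Walk.isPath_of_length_eq_dist _ (by rw [SimpleGraph.Walk.length_concat]; omega)
  have h3 := (hT.existsUnique_path u v).unique h1 h2
  have h4 := congrArg SimpleGraph.Walk.penultimate h3
  simpa using h4

lemma dist_adj (hT : T.IsTree) (u : V) {v w : V} (h : T.Adj v w) :
    T.dist u v = T.dist u w + 1 ∨ T.dist u w = T.dist u v + 1 :=
  (hT.dist_eq_dist_add_one_of_adj u h)

/-- The neighbour of `v` closest to `u`. -/
noncomputable def par (T : SimpleGraph V) (u v : V) : V :=
  open Classical in
  if h : ∃ p, T.Adj v p ∧ T.dist u v = T.dist u p + 1 then h.choose else v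

lemma par_spec (hT : T.IsTree) {u v : V} (h : u ≠ v) :
    T.Adj v (par T u v) ∧ T.dist u v = T.dist u (par T u v) + 1 := by
  have := exists_adj_dist hT h
  rw [par, dif_pos this]
  exact this.choose_spec

lemma par_eq (hT : T.IsTree) {u v p : V} (hp : T.Adj v p) (hd : T.dist u v = T.dist u p + 1) :
    par T u v = p := by
  have hne : u ≠ v := by
    rintro rfl
    rw [SimpleGraph.dist_self] at hd
    omega
  exact adj_dist_unique hT (par_spec hT hne).1 hp (par_spec hT hne).2 hd

lemma map_par (hT : T.IsTree) (g : T ≃g T) {u v : V} (h : u ≠ v) :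
    g (par T u v) = par T (g u) (g v) := by
  obtain ⟨h1, h2⟩ := par_spec hT h
  refine (par_eq hT (g.map_adj_iff.2 h1) ?_).symm
  rw [dist_map hT, dist_map hT, h2]

lemma dist_eq_add_of_adj (hT : T.IsTree) {o y y' : V} (hadj : T.Adj y y')
    (ho : T.dist o y = T.dist o y' + 1) (k : ℕ) :
    ∀ u, T.dist y u = k → T.dist u y' = T.dist u y + 1 →
      T.dist o u = T.dist o y + k ∧ (u = y ∨ T.dist o u = T.dist o (par T y u) + 1) := by
  induction k with
  | zero =>
    intro u hu _
    have := hT.connected.dist_eq_zero_iff.1 hu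
    subst this
    exact ⟨rfl, Or.inl rfl⟩
  | succ k ih =>
    intro u hu hu'
    have hne : y ≠ u := by
      rintro rfl
      rw [SimpleGraph.dist_self] at hu
      omega
    obtain ⟨h1, h2⟩ := par_spec hT hne
    set q := par T y u with hq
    have hy'q : T.dist q y' = T.dist q y + 1 := by
      rcases dist_adj hT q hadj with h | h
      · exfalso
        have t1 := hT.connected.dist_triangle (u := u) (v := q) (w := y')
        have t2 : T.dist u q = 1 := SimpleGraph.dist_eq_one_iff_adj.2 h1
        rw [T.dist_comm (u := y) (v := u)] at h2
        rw [T.dist_comm (u := y) (v := q)] at h2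
        omega
      · exact h
    obtain ⟨i1, i2⟩ := ih q (by omega) hy'q
    suffices h : T.dist o u = T.dist o q + 1 by exact ⟨by omega, Or.inr h⟩
    rcases dist_adj hT o h1 with h | h
    · exact h
    · exfalso
      rcases i2 with i2 | i2
      · rw [i2] at h h1
        have := adj_dist_unique hT h1.symm hadj h ho
        subst this
        rw [SimpleGraph.dist_self] at hu'
        omega
      · have hne' : y ≠ q := by
          intro h'
          rw [← h'] at i2 h h1
          have e1 : T.dist y u = 1 := SimpleGraph.dist_eq_one_iff_adj.2 h1.symm
          have := adj_dist_unique hT h1.symm hadj h ho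
          subst this
          rw [SimpleGraph.dist_self] at hu'
          omega
        obtain ⟨j1, j2⟩ := par_spec hT hne'
        have := adj_dist_unique hT h1.symm j1 h i2
        rw [← this] at j2
        omega

/-- Along a geodesic issuing from `u`, the distance to `o` increases once it exceeds its initial
value. -/
lemma dist_succ_of_lt (hT : T.IsTree) {o u y y' : V} (hadj : T.Adj y y')
    (hu : T.dist u y' = T.dist u y + 1) (hlt : T.dist o u < T.dist o y) :
    T.dist o y' = T.dist o y + 1 := by
  rcases dist_adj hT o hadj with h | h
  · have := (dist_eq_add_of_adj hT hadj h _ u rfl hu).1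
    omega
  · exact h

lemma ancestor_unique (hT : T.IsTree) {o : V} (k : ℕ) :
    ∀ {u u' b : V}, T.dist u b = k → T.dist u' b = k → T.dist o b = T.dist o u + k →
      T.dist o b = T.dist o u' + k → u = u' := by
  induction k with
  | zero =>
    intro u u' b h1 h2 _ _
    rw [hT.connected.dist_eq_zero_iff.1 h1, hT.connected.dist_eq_zero_iff.1 h2]
  | succ k ih =>
    have key : ∀ {u b : V}, T.dist u b = k + 1 → T.dist o b = T.dist o u + (k + 1) →
        T.dist u (par T o b) = k ∧ T.dist o (par T o b) = T.dist o u + k := by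
      intro u b h1 h2
      have hne : u ≠ b := by
        rintro rfl
        rw [SimpleGraph.dist_self] at h1
        omega
      obtain ⟨p1, p2⟩ := par_spec hT hne
      have t1 := hT.connected.dist_triangle (u := o) (v := u) (w := par T u b)
      have e := dist_adj hT o p1
      have : par T o b = par T u b := par_eq hT p1 (by omega)
      rw [this]
      omega
    intro u u' b h1 h2 h3 h4
    obtain ⟨a1, a2⟩ := key h1 h3
    obtain ⟨b1, b2⟩ := key h2 h4
    exact ih a1 b1 a2 b2

lemma ball_finite [T.LocallyFinite] (hT : T.IsTree) (o : V) (r : ℕ) :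
    {v | T.dist o v ≤ r}.Finite := by
  induction r with
  | zero =>
    refine (Set.finite_singleton o).subset fun v hv => ?_
    exact (hT.connected.dist_eq_zero_iff.1 (Nat.le_zero.1 hv)).symm
  | succ r ih =>
    refine (ih.union (ih.biUnion fun v _ => (T.neighborFinset v).finite_toSet)).subset ?_
    intro v hv
    by_cases h : o = v
    · left
      subst h
      simp
    · obtain ⟨h1, h2⟩ := par_spec hT h
      right
      simp only [Set.mem_ofPred_eq] at hv
      refine Set.mem_biUnion (x := par T o v) (by simp only [Set.mem_ofPred_eq]; omega) ?_
      simpa using h1.symm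

lemma countable_vertices [T.LocallyFinite] (hT : T.IsTree) : Countable V := by
  obtain ⟨o⟩ := hT.connected.nonempty
  rw [← Set.countable_univ_iff]
  refine (Set.countable_iUnion fun r => (ball_finite hT o r).countable).mono fun v _ => ?_
  exact Set.mem_iUnion.2 ⟨T.dist o v, by simp⟩

lemma infinite_vertices [T.LocallyFinite] (hT : T.IsTree) {d : ℕ} (hd : 3 ≤ d)
    (hreg : T.IsRegularOfDegree d) : Infinite V := by
  classical
  by_contra h
  rw [not_infinite_iff_finite] at h
  obtain ⟨o⟩ := hT.connected.nonempty
  have : Nontrivial V := by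
    have h1 := hreg o
    have h2 : (T.neighborFinset o).Nonempty := by
      rw [← Finset.card_pos, SimpleGraph.card_neighborFinset_eq_degree]
      omega
    obtain ⟨v, hv⟩ := h2
    exact ⟨o, v, ((T.mem_neighborFinset o v).1 hv).ne⟩
  have := Fintype.ofFinite V
  obtain ⟨v, -, -, hv, -⟩ := hT.exists_ne_and_degree_eq_one
  have := hreg v
  omega

end Geometry

section Twist

variable {V : Type*} {T : SimpleGraph V}

/-- `c` is a child of `b` in the tree rooted at `o`. -/
def Child (T : SimpleGraph V) (o b c : V) : Prop :=
  T.Adj b c ∧ T.dist o c = T.dist o b + 1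

lemma Child.par_eq (hT : T.IsTree) {o b c : V} (h : Child T o b c) : par T o c = b :=
  TreeAut.par_eq hT h.1.symm h.2

lemma child_par (hT : T.IsTree) {o v : V} (h : o ≠ v) : Child T o (par T o v) v :=
  ⟨(par_spec hT h).1.symm, (par_spec hT h).2⟩

lemma card_child [T.LocallyFinite] (hT : T.IsTree) {d : ℕ} (hreg : T.IsRegularOfDegree d)
    {o b : V} (hb : o ≠ b) : Nat.card {c // Child T o b c} = d - 1 := by
  classical
  have h1 : (T.neighborFinset b).card = d := hreg b
  obtain ⟨p1, p2⟩ := par_spec hT hb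
  have h2 : ((T.neighborFinset b).erase (par T o b)).card = d - 1 := by
    rw [Finset.card_erase_of_mem (by simpa using p1), h1]
  rw [← h2]
  refine Nat.subtype_card _ fun c => ?_
  rw [Finset.mem_erase, SimpleGraph.mem_neighborFinset, Child]
  constructor
  · rintro ⟨hne, hadj⟩
    refine ⟨hadj, ?_⟩
    rcases dist_adj hT o hadj with h | h
    · exact absurd (par_eq hT hadj h).symm hne
    · exact h
  · rintro ⟨hadj, h⟩
    refine ⟨?_, hadj⟩
    rintro rfl
    omega

lemma exists_labeling [T.LocallyFinite] (hT : T.IsTree) {d : ℕ} (hd : 3 ≤ d)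
    (hreg : T.IsRegularOfDegree d) (o : V) :
    ∃ (ch : V → Fin (d - 1) → V) (lab : V → Fin (d - 1)),
      (∀ u k, o ≠ u → Child T o u (ch u k) ∧ lab (ch u k) = k) ∧
      ∀ u v, o ≠ u → Child T o u v → ch u (lab v) = v := by
  classical
  have he : ∀ u, o ≠ u → Nonempty (Fin (d - 1) ≃ {c // Child T o u c}) := by
    intro u hu
    have hcard := card_child hT hreg hu
    have : Finite {c // Child T o u c} := Nat.finite_of_card_ne_zero (by omega)
    exact ⟨(Finite.equivFinOfCardEq hcard).symm⟩
  let e : ∀ u, o ≠ u → (Fin (d - 1) ≃ {c // Child T o u c}) := fun u hu => (he u hu).some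
  let ch : V → Fin (d - 1) → V := fun u k => if hu : o ≠ u then (e u hu k : V) else u
  have hch : ∀ u (hu : o ≠ u) k, ch u k = e u hu k := fun u hu k => dif_pos hu
  have hlab : ∀ v, ∃ k : Fin (d - 1), o ≠ par T o v → Child T o (par T o v) v →
      ch (par T o v) k = v := by
    intro v
    by_cases h : o ≠ par T o v ∧ Child T o (par T o v) v
    · exact ⟨(e _ h.1).symm ⟨v, h.2⟩, fun _ _ => by rw [hch _ h.1]; simp⟩
    · exact ⟨⟨0, by omega⟩, fun h1 h2 => absurd ⟨h1, h2⟩ h⟩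
  choose lab hlab using hlab
  have hlab' : ∀ u v, o ≠ u → Child T o u v → ch u (lab v) = v := by
    intro u v hu hc
    have hp := hc.par_eq hT
    have := hlab v
    rw [hp] at this
    exact this hu hc
  have hchild : ∀ u k, o ≠ u → Child T o u (ch u k) := by
    intro u k hu
    rw [hch u hu]
    exact (e u hu k).2
  refine ⟨ch, lab, fun u k hu => ⟨hchild u k hu, ?_⟩, hlab'⟩
  have h1 := hlab' u _ hu (hchild u k hu)
  rw [hch u hu, hch u hu] at h1
  rw [hch u hu]
  exact (e u hu).injective (Subtype.ext h1)

/-- Auxiliary map on the sphere of radius `n`: permute by `π` the labels of the children of `b`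
and keep all other labels. -/
noncomputable def twistAux {k : ℕ} (T : SimpleGraph V) (o b : V) (ch : V → Fin k → V)
    (lab : V → Fin k) (π : Equiv.Perm (Fin k)) : ℕ → V → V
  | 0, v => v
  | n + 1, v =>
    open Classical in
    if n + 1 ≤ T.dist o b then v
    else ch (twistAux T o b ch lab π n (par T o v))
      (if par T o v = b then π (lab v) else lab v)

/-- The automorphism `h` fixes every vertex which is not a proper descendant of `b`, in the form in
which this is used: vertices of level at most that of `b`, and neighbours of such vertices other
than `b`. -/
structure SupportedBelow (T : SimpleGraph V) (o b : V) (h : T ≃g T) : Prop where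
  fix : ∀ v, T.dist o v ≤ T.dist o b → h v = v
  fix_adj : ∀ v u, T.Adj v u → T.dist o v ≤ T.dist o b → v ≠ b → h u = u

section

variable {k : ℕ} {o b : V} {ch : V → Fin k → V} {lab : V → Fin k}

lemma twistAux_of_le (π : Equiv.Perm (Fin k)) {n : ℕ} (h : n ≤ T.dist o b) (v : V) :
    twistAux T o b ch lab π n v = v := by
  cases n with
  | zero => rfl
  | succ n => rw [twistAux, if_pos h]

lemma dist_twistAux (hT : T.IsTree) (hb : o ≠ b)
    (hch : ∀ u k, o ≠ u → Child T o u (ch u k) ∧ lab (ch u k) = k)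
    (π : Equiv.Perm (Fin k)) (n : ℕ) :
    ∀ v, T.dist o v = n → T.dist o (twistAux T o b ch lab π n v) = n := by
  induction n with
  | zero => exact fun v hv => hv
  | succ n ih =>
    intro v hv
    rw [twistAux]
    split_ifs with h
    · exact hv
    all_goals
      have hv0 : o ≠ v := by
        rintro rfl
        rw [SimpleGraph.dist_self] at hv
        omega
      have h1 := (par_spec hT hv0).2
      have h2 := ih (par T o v) (by omega)
      have h3 : o ≠ twistAux T o b ch lab π n (par T o v) := by
        intro h'
        rw [← h', SimpleGraph.dist_self] at h2
        have := hT.connected.pos_dist_of_ne hb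
        omega
      rw [(hch _ _ h3).1.2, h2]

lemma twistAux_succ (hT : T.IsTree) (hb : o ≠ b)
    (hch : ∀ u k, o ≠ u → Child T o u (ch u k) ∧ lab (ch u k) = k)
    (π : Equiv.Perm (Fin k)) {n : ℕ} {v : V} (hv : T.dist o v = n + 1)
    (hn : T.dist o b ≤ n) :
    Child T o (twistAux T o b ch lab π n (par T o v)) (twistAux T o b ch lab π (n + 1) v) ∧
    (par T o v = b → lab (twistAux T o b ch lab π (n + 1) v) = π (lab v)) ∧
    (par T o v ≠ b → lab (twistAux T o b ch lab π (n + 1) v) = lab v) := by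
  have hv0 : o ≠ v := by
    rintro rfl
    rw [SimpleGraph.dist_self] at hv
    omega
  have h1 := (par_spec hT hv0).2
  have h2 := dist_twistAux hT hb hch π n (par T o v) (by omega)
  have h3 : o ≠ twistAux T o b ch lab π n (par T o v) := by
    intro h'
    rw [← h', SimpleGraph.dist_self] at h2
    have := hT.connected.pos_dist_of_ne hb
    omega
  rw [twistAux, if_neg (by omega)]
  refine ⟨(hch _ _ h3).1, fun h => ?_, fun h => ?_⟩
  · rw [(hch _ _ h3).2, if_pos h]
  · rw [(hch _ _ h3).2, if_neg h]

lemma twistAux_inv (hT : T.IsTree) (hb : o ≠ b)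
    (hch : ∀ u k, o ≠ u → Child T o u (ch u k) ∧ lab (ch u k) = k)
    (hlab : ∀ u v, o ≠ u → Child T o u v → ch u (lab v) = v)
    (π : Equiv.Perm (Fin k)) (n : ℕ) :
    ∀ v, T.dist o v = n →
      twistAux T o b ch lab π⁻¹ n (twistAux T o b ch lab π n v) = v := by
  induction n with
  | zero => exact fun v _ => rfl
  | succ n ih =>
    intro v hv
    by_cases hn : n + 1 ≤ T.dist o b
    · rw [twistAux_of_le π hn, twistAux_of_le _ hn]
    have hn' : T.dist o b ≤ n := by omega
    have hv0 : o ≠ v := by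
      rintro rfl
      rw [SimpleGraph.dist_self] at hv
      omega
    have hpv := (par_spec hT hv0).2
    have hpo : o ≠ par T o v := by
      intro h'
      rw [← h', SimpleGraph.dist_self] at hpv
      have := hT.connected.pos_dist_of_ne hb
      omega
    obtain ⟨c1, c2, c3⟩ := twistAux_succ (ch := ch) (lab := lab) hT hb hch π hv hn'
    set w := twistAux T o b ch lab π (n + 1) v with hw
    have hpw := c1.par_eq hT
    have hwd : T.dist o w = n + 1 := dist_twistAux hT hb hch π (n + 1) v hv
    obtain ⟨e1, e2, e3⟩ := twistAux_succ (ch := ch) (lab := lab) hT hb hch π⁻¹ hwd hn'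
    rw [hpw, ih (par T o v) (by omega)] at e1
    have hiff : par T o w = b ↔ par T o v = b := by
      rw [hpw]
      constructor
      · intro h
        have := dist_twistAux (lab := lab) hT hb hch π n (par T o v) (by omega)
        rw [h] at this
        rwa [twistAux_of_le π this.ge] at h
      · intro h
        rw [twistAux_of_le π (by rw [← h]; omega), h]
    have hl : lab (twistAux T o b ch lab π⁻¹ (n + 1) w) = lab v := by
      by_cases hpb : par T o v = b
      · rw [e2 (hiff.2 hpb), c2 hpb]
        simp
      · rw [e3 (fun h => hpb (hiff.1 h)), c3 hpb]
    rw [← hlab _ _ hpo e1, hl, hlab _ _ hpo (child_par hT hv0)]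

lemma twistAux_adj (hT : T.IsTree) (hb : o ≠ b)
    (hch : ∀ u k, o ≠ u → Child T o u (ch u k) ∧ lab (ch u k) = k)
    (π : Equiv.Perm (Fin k)) {u v : V} (h : Child T o u v) :
    T.Adj (twistAux T o b ch lab π (T.dist o u) u) (twistAux T o b ch lab π (T.dist o v) v) := by
  rw [h.2]
  by_cases hn : T.dist o u + 1 ≤ T.dist o b
  · rw [twistAux_of_le π hn, twistAux_of_le π (by omega)]
    exact h.1
  · have := (twistAux_succ (ch := ch) (lab := lab) hT hb hch π h.2 (by omega)).1
    rw [h.par_eq hT] at this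
    exact this.1

end

/-- Every permutation of the children of `b ≠ o` extends to an automorphism supported below `b`. -/
lemma exists_twist [T.LocallyFinite] (hT : T.IsTree) {d : ℕ} (hd : 3 ≤ d)
    (hreg : T.IsRegularOfDegree d) {o b : V} (hb : o ≠ b) :
    ∃ (lab : V → Fin (d - 1)) (H : Equiv.Perm (Fin (d - 1)) → (T ≃g T)),
      Set.InjOn lab {c | Child T o b c} ∧ ∀ π, SupportedBelow T o b (H π) ∧
        ∀ c, Child T o b c → Child T o b (H π c) ∧ lab (H π c) = π (lab c) := by
  obtain ⟨ch, lab, hch, hlab⟩ := exists_labeling hT hd hreg o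
  let f : Equiv.Perm (Fin (d - 1)) → V → V :=
    fun π v => twistAux T o b ch lab π (T.dist o v) v
  have hfd : ∀ π v, T.dist o (f π v) = T.dist o v := fun π v =>
    dist_twistAux hT hb hch π _ v rfl
  have hinv : ∀ π v, f π⁻¹ (f π v) = v := by
    intro π v
    have := twistAux_inv hT hb hch hlab π _ v rfl
    change twistAux T o b ch lab π⁻¹ (T.dist o (f π v)) (f π v) = v
    rw [hfd]
    exact this
  have hinv' : ∀ π v, f π (f π⁻¹ v) = v := by
    intro π v
    have := hinv π⁻¹ v
    rwa [inv_inv] at this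
  have hadj : ∀ π u v, T.Adj u v → T.Adj (f π u) (f π v) := by
    intro π u v huv
    rcases dist_adj hT o huv with h | h
    · exact (twistAux_adj hT hb hch π ⟨huv.symm, h⟩).symm
    · exact twistAux_adj hT hb hch π ⟨huv, h⟩
  let H : Equiv.Perm (Fin (d - 1)) → (T ≃g T) := fun π =>
    { toFun := f π
      invFun := f π⁻¹
      left_inv := hinv π
      right_inv := hinv' π
      map_rel_iff' := by
        intro u v
        refine ⟨fun h => ?_, hadj π u v⟩
        have := hadj π⁻¹ _ _ h
        simpa only [Equiv.coe_fn_mk, hinv] using this }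
  have hH : ∀ π v, H π v = twistAux T o b ch lab π (T.dist o v) v := fun _ _ => rfl
  refine ⟨lab, H, ?_, fun π => ⟨⟨?_, ?_⟩, ?_⟩⟩
  · intro c hc c' hc' h
    rw [← hlab b c hb hc, h, hlab b c' hb hc']
  · intro v hv
    rw [hH, twistAux_of_le π hv]
  · intro v u huv hv hvb
    rw [hH]
    by_cases hu : T.dist o u ≤ T.dist o b
    · exact twistAux_of_le π hu u
    have hc : Child T o v u := ⟨huv, by rcases dist_adj hT o huv with h | h <;> omega⟩
    have hvo : o ≠ v := by
      intro h
      have h1 := hc.2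
      have := hT.connected.pos_dist_of_ne hb
      rw [← h, SimpleGraph.dist_self] at h1
      omega
    have hd' := hc.2
    obtain ⟨c1, c2, c3⟩ := twistAux_succ (ch := ch) (lab := lab) hT hb hch π hc.2 (by omega)
    rw [hc.par_eq hT, twistAux_of_le π hv] at c1
    rw [hd', ← hlab v _ hvo c1, c3 (by rwa [hc.par_eq hT]), hlab v u hvo hc]
  · intro c hc
    obtain ⟨c1, c2, c3⟩ := twistAux_succ (ch := ch) (lab := lab) hT hb hch π hc.2 le_rfl
    rw [hc.par_eq hT, twistAux_of_le π le_rfl] at c1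
    rw [hH, hc.2]
    exact ⟨c1, c2 (hc.par_eq hT)⟩

lemma exists_perm_avoiding {X : Type*} {k : ℕ} (hk : 2 ≤ k) (P : Set X) (f g : X → Fin k)
    (hf : Set.InjOn f P) (hg : Set.InjOn g P) :
    ∃ π : Equiv.Perm (Fin k), ∀ x ∈ P, π (f x) ≠ g x := by
  classical
  let e : {a // a ∈ f '' P} ≃ {a // a ∈ g '' P} :=
    (hf.bijOn_image.equiv f).symm.trans (hg.bijOn_image.equiv g)
  have he : ∀ x (hx : x ∈ P), e.extendSubtype (f x) = g x := by
    intro x hx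
    rw [e.extendSubtype_apply_of_mem _ (Set.mem_image_of_mem f hx)]
    have : (⟨f x, Set.mem_image_of_mem f hx⟩ : {a // a ∈ f '' P}) =
        hf.bijOn_image.equiv f ⟨x, hx⟩ := rfl
    rw [this]
    simp only [e, Equiv.trans_apply, Equiv.symm_apply_apply]
    rfl
  obtain ⟨m, rfl⟩ : ∃ m, k = m + 2 := ⟨k - 2, by omega⟩
  refine ⟨e.extendSubtype.trans (finRotate (m + 2)), fun x hx => ?_⟩
  rw [Equiv.trans_apply, he x hx, finRotate_apply]
  intro h
  simp at h

end Twist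

section Cycles

variable {V : Type*} {T : SimpleGraph V} {n : ℕ}

/-- A letter is a fixed automorphism, or the variable `γ` (`true`), or its inverse (`false`). -/
def letterAct (γ : T ≃g T) : (T ≃g T) ⊕ Bool → (T ≃g T)
  | .inl g => g
  | .inr true => γ
  | .inr false => γ⁻¹

/-- The `j`-th constraint on a closed trajectory `x` of the cyclic word `ℓ` evaluated at `γ`. -/
def Holds (ℓ : ZMod n → (T ≃g T) ⊕ Bool) (γ : T ≃g T) (x : ZMod n → V) (j : ZMod n) : Prop :=
  letterAct γ (ℓ j) (x (j + 1)) = x j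

/-- `x` is a closed trajectory of the cyclic word `ℓ` evaluated at `γ`. -/
def IsCyc (ℓ : ZMod n → (T ≃g T) ⊕ Bool) (γ : T ≃g T) (x : ZMod n → V) : Prop :=
  ∀ j, Holds ℓ γ x j

/-- Index of the endpoint of the `γ`-edge used by the `j`-th letter. -/
def tgt (ℓ : ZMod n → (T ≃g T) ⊕ Bool) (j : ZMod n) : ZMod n :=
  match ℓ j with
  | .inr false => j + 1
  | _ => j

/-- Index of the starting point of the `γ`-edge used by the `j`-th letter. -/
def src (ℓ : ZMod n → (T ≃g T) ⊕ Bool) (j : ZMod n) : ZMod n :=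
  match ℓ j with
  | .inr false => j
  | _ => j + 1

variable {ℓ : ZMod n → (T ≃g T) ⊕ Bool} {γ : T ≃g T}

lemma holds_iff_of_isRight {j : ZMod n} (hj : (ℓ j).isRight) (γ : T ≃g T) (x : ZMod n → V) :
    Holds ℓ γ x j ↔ γ (x (src ℓ j)) = x (tgt ℓ j) := by
  unfold Holds src tgt
  rcases hl : ℓ j with g | c
  · rw [hl] at hj
    exact absurd hj (by simp)
  · cases c
    · simp only [letterAct]
      constructor
      · intro h
        rw [← h, RelIso.apply_inv_self]
      · intro h
        rw [← h, RelIso.inv_apply_self]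
    · simp only [letterAct]

lemma holds_mul_iff {h : T ≃g T} {x : ZMod n → V} {j : ZMod n}
    (hx : (ℓ j).isRight → h (x (tgt ℓ j)) = x (tgt ℓ j)) :
    Holds ℓ (h * γ) x j ↔ Holds ℓ γ x j := by
  by_cases hj : (ℓ j).isRight
  · rw [holds_iff_of_isRight hj, holds_iff_of_isRight hj, RelIso.mul_apply]
    conv_lhs => rw [← hx hj]
    exact h.injective.eq_iff
  · rcases hl : ℓ j with g | c
    · simp only [Holds, hl, letterAct]
    · rw [hl] at hj
      exact absurd rfl hj

lemma cyc_induction [NeZero n] {P : ZMod n → Prop} (h : ∀ j, P j → P (j + 1)) {i : ZMod n}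
    (hi : P i) (j : ZMod n) : P j := by
  have key : ∀ m : ℕ, P (i + m) := by
    intro m
    induction m with
    | zero => simpa using hi
    | succ m ih =>
      have := h _ ih
      rwa [add_assoc, ← Nat.cast_succ] at this
  have := key (j - i).val
  rwa [ZMod.natCast_zmod_val, add_sub_cancel] at this

lemma eq_of_holds_off [NeZero n] {i : ZMod n} {x z : ZMod n → V}
    (hx : ∀ j, j ≠ i → Holds ℓ γ x j) (hz : ∀ j, j ≠ i → Holds ℓ γ z j) {k : ZMod n}
    (hk : x k = z k) : x = z := by
  have step : ∀ j, j ≠ i → (x (j + 1) = z (j + 1) ↔ x j = z j) := by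
    intro j hj
    rw [← hx j hj, ← hz j hj]
    exact (RelIso.injective _).eq_iff.symm
  have key : ∀ m : ℕ, m < n → (x (i + 1 + m) = z (i + 1 + m) ↔ x (i + 1) = z (i + 1)) := by
    intro m
    induction m with
    | zero => simp
    | succ m ih =>
      intro hm
      rw [← ih (by omega), Nat.cast_succ, ← add_assoc]
      refine step _ fun h => ?_
      have h1 : ((m + 1 : ℕ) : ZMod n) = 0 := by
        have : i + ((m + 1 : ℕ) : ZMod n) = i + 0 := by
          rw [add_zero]
          conv_rhs => rw [← h]
          push_cast
          ring
        exact add_left_cancel this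
      rw [ZMod.natCast_eq_zero_iff] at h1
      exact absurd (Nat.le_of_dvd (by omega) h1) (by omega)
  have key' : ∀ j, x j = z j ↔ x (i + 1) = z (i + 1) := by
    intro j
    have := key (j - (i + 1)).val (ZMod.val_lt _)
    rwa [ZMod.natCast_zmod_val, add_sub_cancel] at this
  funext j
  exact (key' j).2 ((key' k).1 hk)

lemma IsCyc.eq [NeZero n] {x z : ZMod n → V} (hx : IsCyc ℓ γ x) (hz : IsCyc ℓ γ z) {k : ZMod n}
    (hk : x k = z k) : x = z :=
  eq_of_holds_off (i := 0) (fun j _ => hx j) (fun j _ => hz j) hk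

lemma IsCyc.dist_eq [NeZero n] (hT : T.IsTree) {x z : ZMod n → V} (hx : IsCyc ℓ γ x)
    (hz : IsCyc ℓ γ z) (j k : ZMod n) : T.dist (x j) (z j) = T.dist (x k) (z k) := by
  refine cyc_induction (P := fun j => T.dist (x j) (z j) = T.dist (x k) (z k)) ?_ rfl j
  intro j hj
  rw [← hj, ← hx j, ← hz j, dist_map hT]

lemma IsCyc.par (hT : T.IsTree) {x y : ZMod n → V} (hx : IsCyc ℓ γ x) (hy : IsCyc ℓ γ y)
    (hne : ∀ k, y k ≠ x k) : IsCyc ℓ γ (fun k => par T (y k) (x k)) := by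
  intro j
  unfold Holds
  rw [map_par hT _ (hne _), hx j, hy j]

/-- `y` is a closed trajectory whose `i`-th `γ`-edge has an endpoint of maximal level, distinct from
the endpoints of its other `γ`-edges. -/
structure Seed (T : SimpleGraph V) (o : V) (ℓ : ZMod n → (T ≃g T) ⊕ Bool) (y : ZMod n → V)
    (i : ZMod n) : Prop where
  gen : (ℓ i).isRight
  ne : o ≠ y (tgt ℓ i)
  max : ∀ j, (ℓ j).isRight → T.dist o (y (tgt ℓ j)) ≤ T.dist o (y (tgt ℓ i))
  simple : ∀ j, (ℓ j).isRight → y (tgt ℓ j) = y (tgt ℓ i) → j = i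

/-- Trajectories at distance `m` from `y` whose `i`-th endpoint is a descendant of that of `y`. -/
def Cand (T : SimpleGraph V) (o : V) (ℓ : ZMod n → (T ≃g T) ⊕ Bool) (y : ZMod n → V)
    (i : ZMod n) (m : ℕ) : Set (ZMod n → V) :=
  {z | (∀ k, T.dist (y k) (z k) = m) ∧
    T.dist o (z (tgt ℓ i)) = T.dist o (y (tgt ℓ i)) + m}

lemma cand_finite [NeZero n] [T.LocallyFinite] (hT : T.IsTree) (o : V) (y : ZMod n → V)
    (i : ZMod n) (m : ℕ) : (Cand T o ℓ y i m).Finite := by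
  have : {f : ZMod n → V | ∀ k, f k ∈ {v | T.dist (y k) v ≤ m}}.Finite :=
    Set.Finite.pi' fun k => ball_finite hT (y k) m
  refine this.subset fun z hz k => ?_
  simp [hz.1 k]

variable {o : V} {y : ZMod n → V} {i : ZMod n} {m : ℕ}

lemma cand_zero (hT : T.IsTree) {z : ZMod n → V} (hz : z ∈ Cand T o ℓ y i 0) : z = y := by
  funext k
  exact (hT.connected.dist_eq_zero_iff.1 (hz.1 k)).symm

lemma exists_parent (hT : T.IsTree) {x : ZMod n → V} (hy : IsCyc ℓ γ y) (hx : IsCyc ℓ γ x)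
    (hc : x ∈ Cand T o ℓ y i (m + 1)) :
    ∃ z ∈ Cand T o ℓ y i m, IsCyc ℓ γ z ∧ ∀ k, T.Adj (z k) (x k) := by
  have hne : ∀ k, y k ≠ x k := by
    intro k h
    have := hc.1 k
    rw [h, SimpleGraph.dist_self] at this
    omega
  have hd : ∀ k, T.dist (y k) (par T (y k) (x k)) = m := by
    intro k
    have h1 := (par_spec hT (hne k)).2
    have h2 := hc.1 k
    omega
  refine ⟨fun k => par T (y k) (x k), ⟨hd, ?_⟩, hx.par hT hy hne,
    fun k => (par_spec hT (hne k)).1.symm⟩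
  have h1 := dist_adj hT o (par_spec hT (hne (tgt ℓ i))).1
  have h2 := hc.2
  have h3 := hT.connected.dist_triangle (u := o) (v := y (tgt ℓ i))
    (w := par T (y (tgt ℓ i)) (x (tgt ℓ i)))
  rw [hd] at h3
  change T.dist o (par T (y (tgt ℓ i)) (x (tgt ℓ i))) = _
  omega

lemma Seed.level_le (hT : T.IsTree) (hs : Seed T o ℓ y i) {z : ZMod n → V}
    (hz : z ∈ Cand T o ℓ y i m) {j : ZMod n} (hj : (ℓ j).isRight) :
    T.dist o (z (tgt ℓ j)) ≤ T.dist o (z (tgt ℓ i)) := by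
  have h1 := hT.connected.dist_triangle (u := o) (v := y (tgt ℓ j)) (w := z (tgt ℓ j))
  have h2 := hs.max j hj
  have h3 := hz.1 (tgt ℓ j)
  have h4 := hz.2
  omega

lemma cand_level_eq {z z' : ZMod n → V}
    (hz : z ∈ Cand T o ℓ y i m) (hz' : z' ∈ Cand T o ℓ y i m) :
    T.dist o (z (tgt ℓ i)) = T.dist o (z' (tgt ℓ i)) := by
  rw [hz.2, hz'.2]

lemma Seed.ne_of_cand (hT : T.IsTree) (hs : Seed T o ℓ y i) {z : ZMod n → V}
    (hz : z ∈ Cand T o ℓ y i m) : o ≠ z (tgt ℓ i) := by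
  intro h
  have h1 := hz.2
  have := hT.connected.pos_dist_of_ne hs.ne
  rw [← h, SimpleGraph.dist_self] at h1
  omega

/-- Endpoints of maximal level of two candidates can only agree at the index `i`. -/
lemma Seed.eq_of_tgt_eq (hT : T.IsTree) (hs : Seed T o ℓ y i) {z z' : ZMod n → V}
    (hz : z ∈ Cand T o ℓ y i m) (hz' : z' ∈ Cand T o ℓ y i m) {j : ZMod n}
    (hj : (ℓ j).isRight) (h : z' (tgt ℓ j) = z (tgt ℓ i)) : j = i := by
  refine hs.simple j hj ?_
  have h1 := hT.connected.dist_triangle (u := o) (v := y (tgt ℓ j)) (w := z' (tgt ℓ j))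
  have h2 := hs.max j hj
  have h3 := hz'.1 (tgt ℓ j)
  have h4 := hz.2
  rw [h] at h1 h3
  exact ancestor_unique hT (o := o) m h3 (hz.1 (tgt ℓ i)) (by omega) h4

lemma Seed.isCyc_mul_iff (hT : T.IsTree) (hs : Seed T o ℓ y i) {z z' : ZMod n → V}
    (hz : z ∈ Cand T o ℓ y i m) (hz' : z' ∈ Cand T o ℓ y i m) {h : T ≃g T}
    (hh : SupportedBelow T o (z (tgt ℓ i)) h) : IsCyc ℓ (h * γ) z' ↔ IsCyc ℓ γ z' := by
  refine forall_congr' fun j => holds_mul_iff fun hj => hh.fix _ ?_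
  rw [cand_level_eq hz hz']
  exact hs.level_le hT hz' hj

lemma Seed.isCyc_mul_iff_self (hs : Seed T o ℓ y i) {z : ZMod n → V}
    (hz : z ∈ Cand T o ℓ y i m) {h : T ≃g T}
    (hh : SupportedBelow T o (z (tgt ℓ i)) h) : IsCyc ℓ (h * γ) y ↔ IsCyc ℓ γ y := by
  refine forall_congr' fun j => holds_mul_iff fun hj => hh.fix _ ?_
  rw [hz.2]
  exact (hs.max j hj).trans (Nat.le_add_right _ _)

lemma Seed.holds_mul_iff_of_adj (hT : T.IsTree) (hs : Seed T o ℓ y i) {z z' x : ZMod n → V}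
    (hz : z ∈ Cand T o ℓ y i m) (hz' : z' ∈ Cand T o ℓ y i m) {h : T ≃g T}
    (hh : SupportedBelow T o (z (tgt ℓ i)) h) (hx : ∀ k, T.Adj (z' k) (x k)) {j : ZMod n}
    (hj : j = i → z' (tgt ℓ i) ≠ z (tgt ℓ i)) : Holds ℓ (h * γ) x j ↔ Holds ℓ γ x j := by
  refine holds_mul_iff fun hjr => hh.fix_adj _ _ (hx _) ?_ ?_
  · rw [cand_level_eq hz hz']
    exact hs.level_le hT hz' hjr
  · intro h'
    have := hs.eq_of_tgt_eq hT hz hz' hjr h'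
    subst this
    exact hj rfl h'

lemma child_of_cand {z x : ZMod n → V} (hz : z ∈ Cand T o ℓ y i m)
    (hx : x ∈ Cand T o ℓ y i (m + 1)) (hadj : ∀ k, T.Adj (z k) (x k)) :
    Child T o (z (tgt ℓ i)) (x (tgt ℓ i)) :=
  ⟨hadj _, by rw [hx.2, hz.2, add_assoc]⟩

variable [NeZero n] [T.LocallyFinite]

/-- The finite set of candidates at distance `m`. -/
noncomputable def candF (hT : T.IsTree) (o : V) (ℓ : ZMod n → (T ≃g T) ⊕ Bool)
    (y : ZMod n → V) (i : ZMod n) (m : ℕ) : Finset (ZMod n → V) :=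
  (cand_finite (ℓ := ℓ) hT o y i m).toFinset

lemma mem_candF (hT : T.IsTree) {z : ZMod n → V} :
    z ∈ candF hT o ℓ y i m ↔ z ∈ Cand T o ℓ y i m :=
  Set.Finite.mem_toFinset _

open Classical in
/-- The candidates adjacent to `z` at the next distance. -/
noncomputable def offspring (hT : T.IsTree) (o : V) (ℓ : ZMod n → (T ≃g T) ⊕ Bool)
    (y : ZMod n → V) (i : ZMod n) (m : ℕ) (z : ZMod n → V) : Finset (ZMod n → V) :=
  (candF hT o ℓ y i (m + 1)).filter fun x => ∀ k, T.Adj (z k) (x k)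

lemma mem_offspring (hT : T.IsTree) {z x : ZMod n → V} :
    x ∈ offspring hT o ℓ y i m z ↔ x ∈ Cand T o ℓ y i (m + 1) ∧ ∀ k, T.Adj (z k) (x k) := by
  classical
  rw [offspring, Finset.mem_filter, mem_candF]

end Cycles

section Measure

lemma continuous_apply_vertex {V : Type*} {T : SimpleGraph V} (a : V) :
    @Continuous (T ≃g T) V _ ⊥ (fun γ : T ≃g T => γ a) := by
  let _ : TopologicalSpace V := ⊥
  exact (continuous_apply (A := fun _ : V => V) a).comp continuous_induced_dom

variable {V : Type*} {T : SimpleGraph V} [MeasurableSpace (T ≃g T)] [BorelSpace (T ≃g T)]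

lemma measurableSet_apply_eq (a b : V) : MeasurableSet {γ : T ≃g T | γ a = b} := by
  let _ : TopologicalSpace V := ⊥
  have : DiscreteTopology V := ⟨rfl⟩
  exact ((isOpen_discrete {b}).preimage (continuous_apply_vertex a)).measurableSet

lemma measurable_mul_left (h : T ≃g T) : Measurable (fun γ : T ≃g T => h * γ) := by
  let _ : TopologicalSpace V := ⊥
  have : DiscreteTopology V := ⟨rfl⟩
  refine Continuous.measurable (continuous_induced_rng.2 (continuous_pi fun v => ?_))
  exact (continuous_of_discreteTopology (f := h)).comp (continuous_apply_vertex v)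

variable {μ : Measure (T ≃g T)} [μ.IsHaarMeasure]

lemma measure_mul_left (h : T ≃g T) {A : Set (T ≃g T)} (hA : MeasurableSet A) :
    μ {γ | h * γ ∈ A} = μ A := by
  conv_rhs => rw [← map_mul_left_eq_self μ h]
  rw [Measure.map_apply (measurable_mul_left h) hA]
  rfl

lemma measure_apply_eq_le (hμ : ∀ v : V, μ {a : T ≃g T | a v = v} = 1) (a b : V) :
    μ {γ : T ≃g T | γ a = b} ≤ 1 := by
  by_cases h : ∃ g : T ≃g T, g a = b
  · obtain ⟨g, rfl⟩ := h
    rw [← hμ (g a), ← measure_mul_left g (measurableSet_apply_eq a (g a)), hμ (g a), ← hμ a]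
    refine measure_mono fun γ hγ => ?_
    exact g.injective hγ
  · have : {γ : T ≃g T | γ a = b} = ∅ := by
      ext γ
      simp only [Set.mem_ofPred_eq, Set.mem_empty_iff_false, iff_false]
      exact fun hγ => h ⟨γ, hγ⟩
    rw [this, measure_empty]
    exact zero_le

variable {n : ℕ} {ℓ : ZMod n → (T ≃g T) ⊕ Bool}

lemma measurableSet_holds (x : ZMod n → V) (j : ZMod n) :
    MeasurableSet {γ : T ≃g T | Holds ℓ γ x j} := by
  by_cases hj : (ℓ j).isRight
  · simp only [holds_iff_of_isRight hj]
    exact measurableSet_apply_eq _ _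
  · rcases hl : ℓ j with g | c
    · simp only [Holds, hl, letterAct]
      exact MeasurableSet.const _
    · rw [hl] at hj
      exact absurd rfl hj

lemma measure_isCyc_le (hμ : ∀ v : V, μ {a : T ≃g T | a v = v} = 1) {i : ZMod n} (hi : (ℓ i).isRight)
    (y : ZMod n → V) : μ {γ : T ≃g T | IsCyc ℓ γ y} ≤ 1 := by
  refine (measure_mono fun γ hγ => ?_).trans
    (measure_apply_eq_le hμ (y (src ℓ i)) (y (tgt ℓ i)))
  exact (holds_iff_of_isRight hi γ y).1 (hγ i)

variable [NeZero n]

lemma measurableSet_holds_off (x : ZMod n → V) (i : ZMod n) :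
    MeasurableSet {γ : T ≃g T | ∀ j, j ≠ i → Holds ℓ γ x j} := by
  simp only [Set.ofPred_forall]
  exact MeasurableSet.iInter fun j => MeasurableSet.iInter fun _ => measurableSet_holds x j

lemma measurableSet_isCyc (x : ZMod n → V) : MeasurableSet {γ : T ≃g T | IsCyc ℓ γ x} := by
  simp only [IsCyc, Set.ofPred_forall]
  exact MeasurableSet.iInter fun j => measurableSet_holds x j

variable {o : V} {y : ZMod n → V} {i : ZMod n}

variable [T.LocallyFinite] {d : ℕ} {m : ℕ}

lemma mul_measure_isCyc_le (hT : T.IsTree) (hd : 3 ≤ d) (hreg : T.IsRegularOfDegree d)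
    (hs : Seed T o ℓ y i) {z x : ZMod n → V} (hz : z ∈ Cand T o ℓ y i m)
    (hx : x ∈ Cand T o ℓ y i (m + 1)) (hadj : ∀ k, T.Adj (z k) (x k)) :
    ((d - 1 : ℕ) : ℝ≥0∞) * μ {γ | (IsCyc ℓ γ y ∧ IsCyc ℓ γ z) ∧ IsCyc ℓ γ x} ≤
      μ {γ | (IsCyc ℓ γ y ∧ IsCyc ℓ γ z) ∧ ∀ j, j ≠ i → Holds ℓ γ x j} := by
  obtain ⟨lab, H, -, hH⟩ := exists_twist hT hd hreg (hs.ne_of_cand hT hz)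
  set t := x (tgt ℓ i) with ht
  have htc : Child T o (z (tgt ℓ i)) t := child_of_cand hz hx hadj
  let c : Fin (d - 1) → V := fun l => H (Equiv.swap (lab t) l) t
  have hc : ∀ l, lab (c l) = l := fun l => by
    rw [((hH _).2 t htc).2, Equiv.swap_apply_left]
  let A : V → Set (T ≃g T) := fun v =>
    {γ | ((IsCyc ℓ γ y ∧ IsCyc ℓ γ z) ∧ ∀ j, j ≠ i → Holds ℓ γ x j) ∧ γ (x (src ℓ i)) = v}
  have hA : ∀ v, MeasurableSet (A v) := fun v =>
    (((measurableSet_isCyc y).inter (measurableSet_isCyc z)).inter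
      (measurableSet_holds_off x i)).inter (measurableSet_apply_eq _ _)
  have hAt : {γ | (IsCyc ℓ γ y ∧ IsCyc ℓ γ z) ∧ IsCyc ℓ γ x} ⊆ A t := by
    rintro γ ⟨h1, h2⟩
    exact ⟨⟨h1, fun j _ => h2 j⟩, (holds_iff_of_isRight hs.gen γ x).1 (h2 i)⟩
  have hAc : ∀ l, μ (A (c l)) = μ (A t) := by
    intro l
    rw [← measure_mul_left (H (Equiv.swap (lab t) l)) (hA (c l))]
    congr 1
    ext γ
    have hsup := (hH (Equiv.swap (lab t) l)).1
    change (((IsCyc ℓ _ y ∧ IsCyc ℓ _ z) ∧ _) ∧ _) ↔ (((_ ∧ _) ∧ _) ∧ _)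
    rw [hs.isCyc_mul_iff_self hz hsup, hs.isCyc_mul_iff hT hz hz hsup, RelIso.mul_apply]
    have h1 : (∀ j, j ≠ i → Holds ℓ (H (Equiv.swap (lab t) l) * γ) x j) ↔
        ∀ j, j ≠ i → Holds ℓ γ x j :=
      forall_congr' fun j => forall_congr' fun hj =>
        hs.holds_mul_iff_of_adj hT hz hz hsup hadj fun h => absurd h hj
    rw [h1]
    exact and_congr_right fun _ => (RelIso.injective _).eq_iff
  calc ((d - 1 : ℕ) : ℝ≥0∞) * μ {γ | (IsCyc ℓ γ y ∧ IsCyc ℓ γ z) ∧ IsCyc ℓ γ x}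
      ≤ ((d - 1 : ℕ) : ℝ≥0∞) * μ (A t) := by gcongr
    _ = ∑ l : Fin (d - 1), μ (A (c l)) := by
        simp only [hAc, Finset.sum_const, Finset.card_univ, Fintype.card_fin, nsmul_eq_mul]
    _ = μ (⋃ l ∈ (Finset.univ : Finset (Fin (d - 1))), A (c l)) := by
        refine (measure_biUnion_finset ?_ fun l _ => hA _).symm
        intro l _ l' _ hne
        refine Set.disjoint_left.2 fun γ h1 h2 => hne ?_
        rw [← hc l, ← hc l', ← h1.2, ← h2.2]
    _ ≤ _ := by
        refine measure_mono fun γ hγ => ?_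
        simp only [Set.mem_iUnion] at hγ
        obtain ⟨l, -, h⟩ := hγ
        exact h.1

lemma sum_measure_off_le (hT : T.IsTree) (hd : 3 ≤ d) (hreg : T.IsRegularOfDegree d)
    (hs : Seed T o ℓ y i) {z : ZMod n → V} (hz : z ∈ Cand T o ℓ y i m) :
    ∑ x ∈ offspring hT o ℓ y i m z,
      μ {γ | (IsCyc ℓ γ y ∧ IsCyc ℓ γ z) ∧ ∀ j, j ≠ i → Holds ℓ γ x j} ≤
      ((d - 1 : ℕ) : ℝ≥0∞) * μ {γ | IsCyc ℓ γ y ∧ IsCyc ℓ γ z} := by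
  classical
  obtain ⟨lab, H, hlab, -⟩ := exists_twist hT hd hreg (hs.ne_of_cand hT hz)
  rw [← Finset.sum_fiberwise_of_maps_to (t := (Finset.univ : Finset (Fin (d - 1))))
    (g := fun x => lab (x (tgt ℓ i))) (fun _ _ => Finset.mem_univ _)]
  calc _ ≤ ∑ _l : Fin (d - 1), μ {γ | IsCyc ℓ γ y ∧ IsCyc ℓ γ z} := by
        refine Finset.sum_le_sum fun l _ => ?_
        rw [← measure_biUnion_finset]
        · refine measure_mono fun γ hγ => ?_
          simp only [Set.mem_iUnion] at hγ
          obtain ⟨x, -, h⟩ := hγ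
          exact h.1
        · intro x hx x' hx' hne
          refine Set.disjoint_left.2 fun γ h1 h2 => hne ?_
          simp only [Finset.coe_filter, Set.mem_ofPred_eq, mem_offspring] at hx hx'
          refine eq_of_holds_off h1.2 h2.2 (k := tgt ℓ i) ?_
          exact hlab (child_of_cand hz hx.1.1 hx.1.2) (child_of_cand hz hx'.1.1 hx'.1.2)
            (hx.2.trans hx'.2.symm)
        · exact fun x _ => ((measurableSet_isCyc y).inter (measurableSet_isCyc z)).inter
            (measurableSet_holds_off x i)
    _ = _ := by
        simp only [Finset.sum_const, Finset.card_univ, Fintype.card_fin, nsmul_eq_mul]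

lemma sum_measure_offspring_le (hT : T.IsTree) (hd : 3 ≤ d) (hreg : T.IsRegularOfDegree d)
    (hs : Seed T o ℓ y i) {z : ZMod n → V} (hz : z ∈ Cand T o ℓ y i m) :
    ∑ x ∈ offspring hT o ℓ y i m z, μ {γ | (IsCyc ℓ γ y ∧ IsCyc ℓ γ z) ∧ IsCyc ℓ γ x} ≤
      μ {γ | IsCyc ℓ γ y ∧ IsCyc ℓ γ z} := by
  have h0 : ((d - 1 : ℕ) : ℝ≥0∞) ≠ 0 := by
    rw [Nat.cast_ne_zero]
    omega
  refine (ENNReal.mul_le_mul_iff_right h0 (ENNReal.natCast_ne_top _)).1 ?_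
  refine le_trans ?_ (sum_measure_off_le hT hd hreg hs hz)
  rw [Finset.mul_sum]
  refine Finset.sum_le_sum fun x hx => ?_
  rw [mem_offspring] at hx
  exact mul_measure_isCyc_le hT hd hreg hs hz hx.1 hx.2

lemma sum_measure_candF_succ_le (hT : T.IsTree) (hd : 3 ≤ d) (hreg : T.IsRegularOfDegree d)
    (hs : Seed T o ℓ y i) (m : ℕ) :
    ∑ x ∈ candF hT o ℓ y i (m + 1), μ {γ | IsCyc ℓ γ y ∧ IsCyc ℓ γ x} ≤
      ∑ z ∈ candF hT o ℓ y i m, μ {γ | IsCyc ℓ γ y ∧ IsCyc ℓ γ z} := by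
  classical
  calc ∑ x ∈ candF hT o ℓ y i (m + 1), μ {γ | IsCyc ℓ γ y ∧ IsCyc ℓ γ x}
      ≤ ∑ x ∈ candF hT o ℓ y i (m + 1), ∑ z ∈ candF hT o ℓ y i m,
          if ∀ k, T.Adj (z k) (x k) then
            μ {γ | (IsCyc ℓ γ y ∧ IsCyc ℓ γ z) ∧ IsCyc ℓ γ x} else 0 := by
        refine Finset.sum_le_sum fun x hx => ?_
        rw [← Finset.sum_filter]
        refine le_trans (measure_mono ?_) (measure_biUnion_finset_le _ _)
        rintro γ ⟨h1, h2⟩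
        obtain ⟨z, hz, hzc, hadj⟩ := exists_parent hT h1 h2 ((mem_candF hT).1 hx)
        simp only [Set.mem_iUnion]
        exact ⟨z, Finset.mem_filter.2 ⟨(mem_candF hT).2 hz, hadj⟩, ⟨h1, hzc⟩, h2⟩
    _ = ∑ z ∈ candF hT o ℓ y i m, ∑ x ∈ offspring hT o ℓ y i m z,
          μ {γ | (IsCyc ℓ γ y ∧ IsCyc ℓ γ z) ∧ IsCyc ℓ γ x} := by
        rw [Finset.sum_comm]
        refine Finset.sum_congr rfl fun z _ => ?_
        rw [← Finset.sum_filter]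
        rfl
    _ ≤ _ := Finset.sum_le_sum fun z hz =>
        sum_measure_offspring_le hT hd hreg hs ((mem_candF hT).1 hz)

lemma sum_measure_candF_le_one (hT : T.IsTree) (hd : 3 ≤ d) (hreg : T.IsRegularOfDegree d)
    (hμ : ∀ v : V, μ {a : T ≃g T | a v = v} = 1) (hs : Seed T o ℓ y i) (m : ℕ) :
    ∑ z ∈ candF hT o ℓ y i m, μ {γ | IsCyc ℓ γ y ∧ IsCyc ℓ γ z} ≤ 1 := by
  induction m with
  | zero =>
    have hsub : candF hT o ℓ y i 0 ⊆ {y} := fun z hz =>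
      Finset.mem_singleton.2 (cand_zero hT ((mem_candF hT).1 hz))
    refine (Finset.sum_le_sum_of_subset hsub).trans ?_
    rw [Finset.sum_singleton]
    exact (measure_mono fun γ hγ => hγ.1).trans (measure_isCyc_le hμ hs.gen y)
  | succ m ih => exact (sum_measure_candF_succ_le hT hd hreg hs m).trans ih

end Measure

section Extinction

variable {V : Type*} {T : SimpleGraph V} [MeasurableSpace (T ≃g T)] [BorelSpace (T ≃g T)]
  {μ : Measure (T ≃g T)} [μ.IsHaarMeasure] {n : ℕ} [NeZero n]
  {ℓ : ZMod n → (T ≃g T) ⊕ Bool} {o : V} {y : ZMod n → V} {i : ZMod n}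
  [T.LocallyFinite] {d : ℕ} {m : ℕ}

/-- The automorphisms for which exactly the candidates in `R` are closed trajectories and those in
`R'` have no offspring. -/
def deadOn (hT : T.IsTree) (o : V) (ℓ : ZMod n → (T ≃g T) ⊕ Bool) (y : ZMod n → V)
    (i : ZMod n) (m : ℕ) (R R' : Finset (ZMod n → V)) : Set (T ≃g T) :=
  {γ | (IsCyc ℓ γ y ∧ ∀ z ∈ candF hT o ℓ y i m, IsCyc ℓ γ z ↔ z ∈ R) ∧
    ∀ z ∈ R', ∀ x ∈ offspring hT o ℓ y i m z, ¬ IsCyc ℓ γ x}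

lemma measurableSet_deadOn (hT : T.IsTree) (R R' : Finset (ZMod n → V)) :
    MeasurableSet (deadOn hT o ℓ y i m R R') := by
  have h1 : MeasurableSet {γ | ∀ z ∈ candF hT o ℓ y i m, IsCyc ℓ γ z ↔ z ∈ R} := by
    simp only [Set.ofPred_forall]
    refine Finset.measurableSet_biInter _ fun z _ => ?_
    by_cases hz : z ∈ R
    · simp only [hz, iff_true]
      exact measurableSet_isCyc z
    · simp only [hz, iff_false]
      exact (measurableSet_isCyc z).compl
  have h2 : MeasurableSet {γ | ∀ z ∈ R', ∀ x ∈ offspring hT o ℓ y i m z, ¬ IsCyc ℓ γ x} := by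
    simp only [Set.ofPred_forall]
    refine Finset.measurableSet_biInter _ fun z _ => ?_
    exact Finset.measurableSet_biInter _ fun x _ => (measurableSet_isCyc x).compl
  exact ((measurableSet_isCyc y).inter h1).inter h2

lemma exists_twist_dead (hT : T.IsTree) (hd : 3 ≤ d)
    (hs : Seed T o ℓ y i) {z : ZMod n → V} (hz : z ∈ Cand T o ℓ y i m) {γ : T ≃g T}
    (hγ : IsCyc ℓ γ z) {lab : V → Fin (d - 1)} {H : Equiv.Perm (Fin (d - 1)) → (T ≃g T)}
    (hlab : Set.InjOn lab {c | Child T o (z (tgt ℓ i)) c})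
    (hH : ∀ π, SupportedBelow T o (z (tgt ℓ i)) (H π) ∧ ∀ c, Child T o (z (tgt ℓ i)) c →
      Child T o (z (tgt ℓ i)) (H π c) ∧ lab (H π c) = π (lab c)) :
    ∃ π, ∀ x ∈ offspring hT o ℓ y i m z, ¬ IsCyc ℓ (H π * γ) x := by
  let P : Set (ZMod n → V) := {x | x ∈ offspring hT o ℓ y i m z ∧
    (∀ j, j ≠ i → Holds ℓ γ x j) ∧ Child T o (z (tgt ℓ i)) (γ (x (src ℓ i)))}
  obtain ⟨π, hπ⟩ := exists_perm_avoiding (k := d - 1) (by omega) P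
    (fun x => lab (γ (x (src ℓ i)))) (fun x => lab (x (tgt ℓ i)))
    (fun x hx x' hx' h => eq_of_holds_off hx.2.1 hx'.2.1
      (γ.injective (hlab hx.2.2 hx'.2.2 h)))
    (fun x hx x' hx' h => by
      have h1 := (mem_offspring hT).1 hx.1
      have h2 := (mem_offspring hT).1 hx'.1
      exact eq_of_holds_off hx.2.1 hx'.2.1
        (hlab (child_of_cand hz h1.1 h1.2) (child_of_cand hz h2.1 h2.2) h))
  refine ⟨π, fun x hx hcyc => ?_⟩
  have hx' := (mem_offspring hT).1 hx
  have htc := child_of_cand hz hx'.1 hx'.2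
  have hoff : ∀ j, j ≠ i → Holds ℓ γ x j := fun j hj =>
    (hs.holds_mul_iff_of_adj hT hz hz (hH π).1 hx'.2 fun h => absurd h hj).1 (hcyc j)
  have hi := (holds_iff_of_isRight hs.gen _ x).1 (hcyc i)
  rw [RelIso.mul_apply] at hi
  by_cases hc : Child T o (z (tgt ℓ i)) (γ (x (src ℓ i)))
  · refine hπ x ⟨hx, hoff, hc⟩ ?_
    rw [← ((hH π).2 _ hc).2, hi]
  · have hadj : T.Adj (z (tgt ℓ i)) (γ (x (src ℓ i))) := by
      rw [← (holds_iff_of_isRight hs.gen γ z).1 (hγ i)]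
      exact γ.map_adj_iff.2 (hx'.2 _)
    have hle : T.dist o (γ (x (src ℓ i))) ≤ T.dist o (z (tgt ℓ i)) := by
      rcases dist_adj hT o hadj with h | h
      · omega
      · exact absurd ⟨hadj, h⟩ hc
    rw [(hH π).1.fix _ hle] at hi
    rw [hi] at hc
    exact hc htc

lemma measure_deadOn_insert [DecidableEq (ZMod n → V)] (hT : T.IsTree) (hd : 3 ≤ d)
    (hreg : T.IsRegularOfDegree d)
    (hs : Seed T o ℓ y i) {R R' : Finset (ZMod n → V)} (hR : R ⊆ candF hT o ℓ y i m)
    (hR' : R' ⊆ R) {z : ZMod n → V} (hz : z ∈ R) (hzR' : z ∉ R') :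
    μ (deadOn hT o ℓ y i m R R') ≤
      ((d - 1).factorial : ℝ≥0∞) * μ (deadOn hT o ℓ y i m R (insert z R')) := by
  have hzc : z ∈ Cand T o ℓ y i m := (mem_candF hT).1 (hR hz)
  obtain ⟨lab, H, hlab, hH⟩ := exists_twist hT hd hreg (hs.ne_of_cand hT hzc)
  have hcov : deadOn hT o ℓ y i m R R' ⊆ ⋃ π ∈ (Finset.univ : Finset (Equiv.Perm (Fin (d - 1)))),
      {γ | H π * γ ∈ deadOn hT o ℓ y i m R (insert z R')} := by
    rintro γ ⟨⟨h1, h2⟩, h3⟩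
    have hγz : IsCyc ℓ γ z := (h2 z (hR hz)).2 hz
    obtain ⟨π, hπ⟩ := exists_twist_dead hT hd hs hzc hγz hlab hH
    simp only [Set.mem_iUnion]
    refine ⟨π, Finset.mem_univ _, ⟨(hs.isCyc_mul_iff_self hzc (hH π).1).2 h1, ?_⟩, ?_⟩
    · intro z' hz'
      rw [hs.isCyc_mul_iff hT hzc ((mem_candF hT).1 hz') (hH π).1]
      exact h2 z' hz'
    · intro z' hz'
      rcases Finset.mem_insert.1 hz' with rfl | hz'
      · exact hπ
      intro x hx hcyc
      refine h3 z' hz' x hx ?_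
      have hz'R := hR (hR' hz')
      have hx' := (mem_offspring hT).1 hx
      intro j
      refine (hs.holds_mul_iff_of_adj hT hzc ((mem_candF hT).1 hz'R) (hH π).1 hx'.2
        fun _ h => ?_).1 (hcyc j)
      have : z' = z := ((h2 z' hz'R).2 (hR' hz')).eq hγz h
      exact hzR' (this ▸ hz')
  refine (measure_mono hcov).trans ((measure_biUnion_finset_le _ _).trans ?_)
  simp only [measure_mul_left _ (measurableSet_deadOn hT R (insert z R')), Finset.sum_const,
    Finset.card_univ, Fintype.card_perm, Fintype.card_fin, nsmul_eq_mul, le_refl]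

lemma measure_deadOn_le (hT : T.IsTree) (hd : 3 ≤ d) (hreg : T.IsRegularOfDegree d)
    (hs : Seed T o ℓ y i) {R : Finset (ZMod n → V)} (hR : R ⊆ candF hT o ℓ y i m) :
    μ (deadOn hT o ℓ y i m R ∅) ≤
      ((d - 1).factorial : ℝ≥0∞) ^ R.card * μ (deadOn hT o ℓ y i m R R) := by
  classical
  have key : ∀ R' : Finset (ZMod n → V), R' ⊆ R → μ (deadOn hT o ℓ y i m R ∅) ≤
      ((d - 1).factorial : ℝ≥0∞) ^ R'.card * μ (deadOn hT o ℓ y i m R R') := by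
    intro R'
    induction R' using Finset.induction_on with
    | empty => intro _; simp
    | insert z R' hz ih =>
      intro h
      have h1 := Finset.insert_subset_iff.1 h
      refine (ih h1.2).trans ?_
      rw [Finset.card_insert_of_notMem hz, pow_succ, mul_assoc]
      gcongr
      exact measure_deadOn_insert hT hd hreg hs hR h1.2 h1.1 hz
  exact key R subset_rfl

/-- The automorphisms having a closed trajectory among the candidates at distance `m`. -/
def alive (T : SimpleGraph V) (o : V) (ℓ : ZMod n → (T ≃g T) ⊕ Bool) (y : ZMod n → V)
    (i : ZMod n) (m : ℕ) : Set (T ≃g T) :=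
  {γ | IsCyc ℓ γ y ∧ ∃ z ∈ Cand T o ℓ y i m, IsCyc ℓ γ z}

lemma measurableSet_alive (hT : T.IsTree) (m : ℕ) : MeasurableSet (alive T o ℓ y i m) := by
  have : alive T o ℓ y i m = {γ | IsCyc ℓ γ y} ∩
      ⋃ z ∈ candF hT o ℓ y i m, {γ | IsCyc ℓ γ z} := by
    ext γ
    simp [alive, mem_candF]
  rw [this]
  exact (measurableSet_isCyc y).inter
    (Finset.measurableSet_biUnion _ fun z _ => measurableSet_isCyc z)

lemma alive_antitone (hT : T.IsTree) : Antitone (alive T o ℓ y i) := by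
  refine antitone_nat_of_succ_le fun m => ?_
  rintro γ ⟨h1, x, hx, hxc⟩
  obtain ⟨z, hz, hzc, -⟩ := exists_parent hT h1 hxc hx
  exact ⟨h1, z, hz, hzc⟩

lemma measure_alive_le_one (hμ : ∀ v : V, μ {a : T ≃g T | a v = v} = 1)
    (hs : Seed T o ℓ y i) (m : ℕ) : μ (alive T o ℓ y i m) ≤ 1 :=
  (measure_mono fun _ h => h.1).trans (measure_isCyc_le hμ hs.gen y)

open Classical in
lemma measure_alive_le (hT : T.IsTree) (hd : 3 ≤ d) (hreg : T.IsRegularOfDegree d)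
    (hμ : ∀ v : V, μ {a : T ≃g T | a v = v} = 1) (hs : Seed T o ℓ y i) (m : ℕ) {K : ℕ}
    (hK : K ≠ 0) :
    μ (alive T o ℓ y i m) ≤
      ((d - 1).factorial : ℝ≥0∞) ^ K * μ (alive T o ℓ y i m \ alive T o ℓ y i (m + 1)) +
      1 / K := by
  set F := candF hT o ℓ y i m with hF
  let S : (T ≃g T) → Finset (ZMod n → V) := fun γ => F.filter fun z => IsCyc ℓ γ z
  have hS : ∀ γ, IsCyc ℓ γ y → γ ∈ deadOn hT o ℓ y i m (S γ) ∅ := by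
    intro γ h
    refine ⟨⟨h, fun z hz => ?_⟩, by simp⟩
    simp only [S, Finset.mem_filter]
    exact ⟨fun h => ⟨hz, h⟩, fun h => h.2⟩
  let 𝓡 : Finset (Finset (ZMod n → V)) := F.powerset.filter fun R => R.Nonempty ∧ R.card ≤ K
  let g : (T ≃g T) → ℝ≥0∞ := fun γ =>
    ∑ z ∈ F, Set.indicator {γ | IsCyc ℓ γ y ∧ IsCyc ℓ γ z} 1 γ
  have hcov : alive T o ℓ y i m ⊆ (⋃ R ∈ 𝓡, deadOn hT o ℓ y i m R ∅) ∪ {γ | (K : ℝ≥0∞) ≤ g γ} := by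
    rintro γ ⟨h1, z, hz, hzc⟩
    by_cases hc : (S γ).card ≤ K
    · left
      simp only [Set.mem_iUnion]
      refine ⟨S γ, ?_, hS γ h1⟩
      refine Finset.mem_filter.2 ⟨Finset.mem_powerset.2 (Finset.filter_subset _ _), ⟨z, ?_⟩, hc⟩
      exact Finset.mem_filter.2 ⟨(mem_candF hT).2 hz, hzc⟩
    · right
      have : g γ = ((S γ).card : ℝ≥0∞) := by
        simp only [g, S, Set.indicator_apply, Set.mem_ofPred_eq, h1, true_and, Pi.one_apply]
        rw [Finset.sum_boole]
      simp only [Set.mem_ofPred_eq, this]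
      exact_mod_cast (by omega : K ≤ (S γ).card)
  have hsmall : μ (⋃ R ∈ 𝓡, deadOn hT o ℓ y i m R ∅) ≤
      ((d - 1).factorial : ℝ≥0∞) ^ K * μ (alive T o ℓ y i m \ alive T o ℓ y i (m + 1)) := by
    calc μ (⋃ R ∈ 𝓡, deadOn hT o ℓ y i m R ∅)
        ≤ ∑ R ∈ 𝓡, μ (deadOn hT o ℓ y i m R ∅) := measure_biUnion_finset_le _ _
      _ ≤ ∑ R ∈ 𝓡, ((d - 1).factorial : ℝ≥0∞) ^ K * μ (deadOn hT o ℓ y i m R R) := by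
          refine Finset.sum_le_sum fun R hR => ?_
          obtain ⟨h1, -, h3⟩ := Finset.mem_filter.1 hR
          refine (measure_deadOn_le hT hd hreg hs (Finset.mem_powerset.1 h1)).trans ?_
          gcongr
          exact_mod_cast Nat.one_le_iff_ne_zero.2 (Nat.factorial_ne_zero _)
      _ = ((d - 1).factorial : ℝ≥0∞) ^ K * μ (⋃ R ∈ 𝓡, deadOn hT o ℓ y i m R R) := by
          rw [← Finset.mul_sum, measure_biUnion_finset]
          · intro R hR R' hR' hne
            refine Set.disjoint_left.2 fun γ h1 h2 => hne ?_
            have hR1 := Finset.mem_powerset.1 (Finset.mem_filter.1 hR).1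
            have hR2 := Finset.mem_powerset.1 (Finset.mem_filter.1 hR').1
            ext z
            exact ⟨fun h => (h2.1.2 z (hR1 h)).1 ((h1.1.2 z (hR1 h)).2 h),
              fun h => (h1.1.2 z (hR2 h)).1 ((h2.1.2 z (hR2 h)).2 h)⟩
          · exact fun R _ => measurableSet_deadOn hT R R
      _ ≤ _ := by
          gcongr
          refine Set.iUnion₂_subset fun R hR => ?_
          obtain ⟨h1, ⟨z, hz⟩, -⟩ := Finset.mem_filter.1 hR
          have hzF := Finset.mem_powerset.1 h1 hz
          rintro γ ⟨⟨hy, hγ⟩, hdead⟩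
          refine ⟨⟨hy, z, (mem_candF hT).1 hzF, (hγ z hzF).2 hz⟩, ?_⟩
          rintro ⟨-, x, hx, hxc⟩
          obtain ⟨z', hz', hzc', hadj⟩ := exists_parent hT hy hxc hx
          exact hdead z' ((hγ z' ((mem_candF hT).2 hz')).1 hzc') x
            ((mem_offspring hT).2 ⟨hx, hadj⟩) hxc
  have hlarge : μ {γ | (K : ℝ≥0∞) ≤ g γ} ≤ 1 / K := by
    have hmeas : ∀ z, MeasurableSet {γ | IsCyc ℓ γ y ∧ IsCyc ℓ γ z} := fun z =>
      (measurableSet_isCyc y).inter (measurableSet_isCyc z)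
    have hg : Measurable g := by
      refine Finset.measurable_sum _ fun z _ => ?_
      exact measurable_one.indicator (hmeas z)
    have hint : ∫⁻ γ, g γ ∂μ ≤ 1 := by
      refine le_trans (le_of_eq ?_) (sum_measure_candF_le_one hT hd hreg hμ hs m)
      rw [lintegral_finsetSum _ fun z _ => measurable_one.indicator (hmeas z)]
      exact Finset.sum_congr rfl fun z _ => lintegral_indicator_one (hmeas z)
    rw [ENNReal.le_div_iff_mul_le (Or.inl (by exact_mod_cast hK))
      (Or.inl (ENNReal.natCast_ne_top K)), mul_comm]
    exact (mul_meas_ge_le_lintegral hg _).trans hint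
  exact (measure_mono hcov).trans ((measure_union_le _ _).trans (add_le_add hsmall hlarge))

lemma measure_iInter_alive (hT : T.IsTree) (hd : 3 ≤ d) (hreg : T.IsRegularOfDegree d)
    (hμ : ∀ v : V, μ {a : T ≃g T | a v = v} = 1) (hs : Seed T o ℓ y i) :
    μ (⋂ m, alive T o ℓ y i m) = 0 := by
  have hfin : ∀ m, μ (alive T o ℓ y i m) ≠ ⊤ := fun m =>
    ((measure_alive_le_one hμ hs m).trans_lt ENNReal.one_lt_top).ne
  have hlim : Filter.Tendsto (fun m => μ (alive T o ℓ y i m)) Filter.atTop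
      (nhds (μ (⋂ m, alive T o ℓ y i m))) :=
    tendsto_measure_iInter_atTop (fun m => (measurableSet_alive hT m).nullMeasurableSet)
      (alive_antitone hT) ⟨0, hfin 0⟩
  set p := μ (⋂ m, alive T o ℓ y i m) with hp
  have hpfin : p ≠ ⊤ := ((measure_mono (Set.iInter_subset _ 0)).trans_lt (hfin 0).lt_top).ne
  have hdiff : Filter.Tendsto
      (fun m => μ (alive T o ℓ y i m \ alive T o ℓ y i (m + 1))) Filter.atTop (nhds 0) := by
    have h1 : ∀ m, μ (alive T o ℓ y i m \ alive T o ℓ y i (m + 1)) =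
        μ (alive T o ℓ y i m) - μ (alive T o ℓ y i (m + 1)) := fun m =>
      measure_sdiff (alive_antitone hT (Nat.le_succ m))
        (measurableSet_alive hT _).nullMeasurableSet (hfin _)
    simp only [h1]
    have := ENNReal.Tendsto.sub hlim (hlim.comp (Filter.tendsto_add_atTop_nat 1)) (Or.inl hpfin)
    rwa [tsub_self] at this
  have hK : ∀ K : ℕ, p ≤ 1 / ((K + 1 : ℕ) : ℝ≥0∞) := by
    intro K
    have h2 : Filter.Tendsto (fun m => ((d - 1).factorial : ℝ≥0∞) ^ (K + 1) *
        μ (alive T o ℓ y i m \ alive T o ℓ y i (m + 1)) + 1 / ((K + 1 : ℕ) : ℝ≥0∞))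
        Filter.atTop (nhds (((d - 1).factorial : ℝ≥0∞) ^ (K + 1) * 0 +
          1 / ((K + 1 : ℕ) : ℝ≥0∞))) := by
      refine Filter.Tendsto.add_const _ (ENNReal.Tendsto.const_mul hdiff (Or.inr ?_))
      exact ENNReal.pow_ne_top (ENNReal.natCast_ne_top _)
    rw [mul_zero, zero_add] at h2
    exact le_of_tendsto_of_tendsto' hlim h2 fun m =>
      measure_alive_le hT hd hreg hμ hs m (Nat.succ_ne_zero K)
  have hz : Filter.Tendsto (fun K : ℕ => 1 / ((K + 1 : ℕ) : ℝ≥0∞)) Filter.atTop (nhds 0) := by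
    simp only [one_div]
    exact ENNReal.tendsto_inv_nat_nhds_zero.comp (Filter.tendsto_add_atTop_nat 1)
  exact le_antisymm (ge_of_tendsto' hz hK) zero_le

/-- Almost surely only finitely many closed trajectories descend from a given seed. -/
lemma ae_finite_descendants (hT : T.IsTree) (hd : 3 ≤ d) (hreg : T.IsRegularOfDegree d)
    (hμ : ∀ v : V, μ {a : T ≃g T | a v = v} = 1) (hs : Seed T o ℓ y i) :
    ∀ᵐ γ ∂μ, IsCyc ℓ γ y → {z | IsCyc ℓ γ z ∧ ∃ m, z ∈ Cand T o ℓ y i m}.Finite := by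
  have h0 := measure_eq_zero_iff_ae_notMem.1 (measure_iInter_alive hT hd hreg hμ hs)
  filter_upwards [h0] with γ hγ hy
  rw [Set.mem_iInter, not_forall] at hγ
  obtain ⟨m, hm⟩ := hγ
  refine ((Finset.range m).finite_toSet.biUnion fun k _ =>
    cand_finite (ℓ := ℓ) hT o y i k).subset ?_
  rintro z ⟨hz, k, hk⟩
  refine Set.mem_biUnion (x := k) ?_ hk
  by_contra hlt
  rw [Finset.mem_coe, Finset.mem_range, not_lt] at hlt
  exact hm (alive_antitone hT hlt ⟨hy, z, hk, hz⟩)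

end Extinction

section Depth

variable {V : Type*} {T : SimpleGraph V} {n : ℕ} [NeZero n]
  {ℓ : ZMod n → (T ≃g T) ⊕ Bool} {γ : T ≃g T} {o : V}

/-- The maximal level of an endpoint of a `γ`-edge of `x`. -/
noncomputable def depth (T : SimpleGraph V) (o : V) (ℓ : ZMod n → (T ≃g T) ⊕ Bool)
    (x : ZMod n → V) : ℕ :=
  (Finset.univ.filter fun j => (ℓ j).isRight = true).sup fun j => T.dist o (x (tgt ℓ j))

lemma le_depth (x : ZMod n → V) {j : ZMod n} (hj : (ℓ j).isRight) :
    T.dist o (x (tgt ℓ j)) ≤ depth T o ℓ x :=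
  Finset.le_sup (f := fun j => T.dist o (x (tgt ℓ j)))
    (Finset.mem_filter.2 ⟨Finset.mem_univ j, hj⟩)

lemma exists_eq_depth (x : ZMod n → V) {i : ZMod n} (hi : (ℓ i).isRight) :
    ∃ j, (ℓ j).isRight ∧ T.dist o (x (tgt ℓ j)) = depth T o ℓ x := by
  obtain ⟨j, hj, h⟩ := Finset.exists_mem_eq_sup
    (Finset.univ.filter fun j => (ℓ j).isRight = true)
    ⟨i, Finset.mem_filter.2 ⟨Finset.mem_univ i, hi⟩⟩ fun j => T.dist o (x (tgt ℓ j))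
  exact ⟨j, (Finset.mem_filter.1 hj).2, h.symm⟩

lemma finite_isCyc_depth_le [T.LocallyFinite] (hT : T.IsTree) {i : ZMod n} (hi : (ℓ i).isRight)
    (M : ℕ) : {x | IsCyc ℓ γ x ∧ depth T o ℓ x ≤ M}.Finite := by
  refine Set.Finite.of_finite_image (f := fun x => x (tgt ℓ i)) ?_
    fun x hx z hz h => hx.1.eq hz.1 h
  refine (ball_finite hT o M).subset ?_
  rintro _ ⟨x, hx, rfl⟩
  exact (le_depth x hi).trans hx.2

lemma depth_par (hT : T.IsTree) {x₀ x : ZMod n → V} (h₀ : IsCyc ℓ γ x₀) (hx : IsCyc ℓ γ x)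
    (hlt : depth T o ℓ x₀ < depth T o ℓ x) {i : ZMod n} (hi : (ℓ i).isRight)
    (hmax : T.dist o (x (tgt ℓ i)) = depth T o ℓ x) :
    ∃ z, IsCyc ℓ γ z ∧ (∀ k, T.Adj (z k) (x k)) ∧ depth T o ℓ z + 1 = depth T o ℓ x ∧
      T.dist o (z (tgt ℓ i)) = depth T o ℓ z := by
  have hne : ∀ k, x₀ k ≠ x k := by
    intro k h
    have := h₀.eq hx h
    subst this
    exact lt_irrefl _ hlt
  let z : ZMod n → V := fun k => par T (x₀ k) (x k)
  have hadj : ∀ k, T.Adj (z k) (x k) := fun k => (par_spec hT (hne k)).1.symm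
  have hdist : ∀ k, T.dist (x₀ k) (x k) = T.dist (x₀ k) (z k) + 1 := fun k =>
    (par_spec hT (hne k)).2
  have hle : ∀ j, (ℓ j).isRight → T.dist o (z (tgt ℓ j)) + 1 ≤ depth T o ℓ x := by
    intro j hj
    by_contra hcon
    have h1 := le_depth (o := o) x₀ hj
    have h2 := dist_succ_of_lt hT (o := o) (hadj (tgt ℓ j)) (hdist _) (by omega)
    have h3 := le_depth (o := o) x hj
    omega
  have hzi : T.dist o (z (tgt ℓ i)) + 1 = depth T o ℓ x := by
    have h1 := hle i hi
    rcases dist_adj hT o (hadj (tgt ℓ i)) with h | h <;> omega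
  have hz : depth T o ℓ z + 1 = depth T o ℓ x := by
    obtain ⟨j, hj, h⟩ := exists_eq_depth (o := o) z hi
    have h1 := hle j hj
    have h2 := le_depth (o := o) z hi
    omega
  exact ⟨z, hx.par hT h₀ hne, hadj, hz, by omega⟩

lemma exists_ancestor (hT : T.IsTree) {x₀ : ZMod n → V} (h₀ : IsCyc ℓ γ x₀) {M : ℕ}
    (hM : depth T o ℓ x₀ < M) {i : ZMod n} (hi : (ℓ i).isRight) (r : ℕ) :
    ∀ x, IsCyc ℓ γ x → depth T o ℓ x = M + r → T.dist o (x (tgt ℓ i)) = depth T o ℓ x →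
      ∃ y, IsCyc ℓ γ y ∧ depth T o ℓ y = M ∧ T.dist o (y (tgt ℓ i)) = M ∧
        x ∈ Cand T o ℓ y i r := by
  induction r with
  | zero =>
    intro x hx hd hmax
    refine ⟨x, hx, hd, by omega, fun k => SimpleGraph.dist_self, rfl⟩
  | succ r ih =>
    intro x hx hd hmax
    obtain ⟨z, hz, hadj, hzd, hzi⟩ := depth_par hT h₀ hx (by omega) hi hmax
    obtain ⟨y, hy, hyd, hyi, hc⟩ := ih z hz (by omega) hzi
    refine ⟨y, hy, hyd, hyi, fun k => ?_, by omega⟩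
    rw [hy.dist_eq hT hx k (tgt ℓ i)]
    have h1 := hT.connected.dist_triangle (u := o) (v := y (tgt ℓ i)) (w := x (tgt ℓ i))
    have h2 := dist_adj hT (y (tgt ℓ i)) (hadj (tgt ℓ i))
    have h3 := hc.1 (tgt ℓ i)
    omega

end Depth

section Finiteness

variable {V : Type*} {T : SimpleGraph V} [MeasurableSpace (T ≃g T)] [BorelSpace (T ≃g T)]
  {μ : Measure (T ≃g T)} [μ.IsHaarMeasure] {n : ℕ} [NeZero n] [T.LocallyFinite] {d : ℕ}

/-- The endpoints of the `γ`-edges of `x` are pairwise distinct. -/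
def SimpleTraj (ℓ : ZMod n → (T ≃g T) ⊕ Bool) (x : ZMod n → V) : Prop :=
  ∀ i j, (ℓ i).isRight → (ℓ j).isRight → x (tgt ℓ i) = x (tgt ℓ j) → i = j

/-- Almost surely, if all but finitely many closed trajectories are simple, then there are only
finitely many closed trajectories. -/
theorem ae_finite_isCyc (hT : T.IsTree) (hd : 3 ≤ d) (hreg : T.IsRegularOfDegree d)
    (hμ : ∀ v : V, μ {a : T ≃g T | a v = v} = 1) (ℓ : ZMod n → (T ≃g T) ⊕ Bool) {i₀ : ZMod n}
    (hi₀ : (ℓ i₀).isRight) :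
    ∀ᵐ γ ∂μ, {x | IsCyc ℓ γ x ∧ ¬ SimpleTraj ℓ x}.Finite → {x | IsCyc ℓ γ x}.Finite := by
  obtain ⟨o⟩ := hT.connected.nonempty
  have : Countable V := countable_vertices hT
  have hae : ∀ᵐ γ ∂μ, ∀ (y : ZMod n → V) (i : ZMod n), Seed T o ℓ y i → IsCyc ℓ γ y →
      {z | IsCyc ℓ γ z ∧ ∃ m, z ∈ Cand T o ℓ y i m}.Finite := by
    rw [ae_all_iff]
    intro y
    rw [ae_all_iff]
    intro i
    by_cases hs : Seed T o ℓ y i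
    · filter_upwards [ae_finite_descendants hT hd hreg hμ hs] with γ hγ _ using hγ
    · exact Filter.Eventually.of_forall fun γ h => absurd h hs
  filter_upwards [hae] with γ hγ hfin
  by_cases hne : ∃ x₀, IsCyc ℓ γ x₀
  swap
  · push Not at hne
    convert Set.finite_empty
    ext x
    simp [hne x]
  obtain ⟨x₀, h₀⟩ := hne
  obtain ⟨M₁, hM₁⟩ := (hfin.image (depth T o ℓ)).bddAbove
  set M := max M₁ (depth T o ℓ x₀) + 1 with hM
  have hsimple : ∀ y, IsCyc ℓ γ y → depth T o ℓ y = M → SimpleTraj ℓ y := by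
    intro y hy hyM
    by_contra hns
    have := hM₁ (Set.mem_image_of_mem (depth T o ℓ)
      (show y ∈ {x | IsCyc ℓ γ x ∧ ¬ SimpleTraj ℓ x} from ⟨hy, hns⟩))
    omega
  have hA := finite_isCyc_depth_le (γ := γ) (o := o) hT hi₀ M
  have hB : (⋃ y ∈ {x | IsCyc ℓ γ x ∧ depth T o ℓ x ≤ M}, ⋃ i : ZMod n,
      {z | Seed T o ℓ y i ∧ IsCyc ℓ γ z ∧ ∃ m, z ∈ Cand T o ℓ y i m}).Finite := by
    refine hA.biUnion fun y hy => Set.finite_iUnion fun i => ?_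
    by_cases hs : Seed T o ℓ y i
    · exact (hγ y i hs hy.1).subset fun z hz => hz.2
    · convert Set.finite_empty
      ext z
      simp [hs]
  refine (hA.union hB).subset fun x hx => ?_
  by_cases hxM : depth T o ℓ x ≤ M
  · exact Or.inl ⟨hx, hxM⟩
  right
  obtain ⟨i, hi, hmax⟩ := exists_eq_depth (o := o) x hi₀
  obtain ⟨y, hy, hyd, hyi, hc⟩ := exists_ancestor hT h₀ (M := M) (by omega) hi
    (depth T o ℓ x - M) x hx (by omega) hmax
  have hs : Seed T o ℓ y i := by
    refine ⟨hi, ?_, fun j hj => ?_, fun j hj h => hsimple y hy hyd j i hj hi h⟩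
    · intro h
      rw [← h, SimpleGraph.dist_self] at hyi
      omega
    · rw [hyi, ← hyd]
      exact le_depth y hj
  simp only [Set.mem_iUnion]
  exact ⟨y, ⟨hy, hyd.le⟩, i, hs, hx, _, hc⟩

end Finiteness

section Words

variable {V : Type*} {T : SimpleGraph V} {Γ : Subgroup (T ≃g T)}

/-- The evaluation homomorphism `Γ * ℤ → Aut T` sending the generator of `ℤ` to `γ`. -/
noncomputable def evalHom (Γ : Subgroup (T ≃g T)) (γ : T ≃g T) :
    Monoid.Coprod Γ (Multiplicative ℤ) →* (T ≃g T) :=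
  Monoid.Coprod.lift Γ.subtype (zpowersHom (T ≃g T) γ)

/-- The letter of `Γ ⊕ {γ, γ⁻¹}` as an element of the free product. -/
def letterWord : Γ ⊕ Bool → Monoid.Coprod Γ (Multiplicative ℤ)
  | .inl g => Monoid.Coprod.inl g
  | .inr true => Monoid.Coprod.inr (Multiplicative.ofAdd 1)
  | .inr false => (Monoid.Coprod.inr (Multiplicative.ofAdd 1))⁻¹

/-- The element of the free product spelled by a list of letters. -/
def spell (l : List (Γ ⊕ Bool)) : Monoid.Coprod Γ (Multiplicative ℤ) :=
  (l.map letterWord).prod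

/-- A letter viewed as a letter over the full automorphism group. -/
def toLetter (a : Γ ⊕ Bool) : (T ≃g T) ⊕ Bool := a.map Subtype.val id

lemma evalHom_inl (γ : T ≃g T) (g : Γ) : evalHom Γ γ (Monoid.Coprod.inl g) = g := rfl

lemma evalHom_inr (γ : T ≃g T) :
    evalHom Γ γ (Monoid.Coprod.inr (Multiplicative.ofAdd 1)) = γ := by
  rw [evalHom, Monoid.Coprod.lift_apply_inr]
  simp

lemma range_evalHom (Γ : Subgroup (T ≃g T)) (γ : T ≃g T) :
    (evalHom Γ γ).range = Subgroup.closure ((Γ : Set (T ≃g T)) ∪ {γ}) := by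
  rw [evalHom, Monoid.Coprod.range_lift, Subgroup.closure_union, Subgroup.closure_eq,
    Subgroup.range_subtype, ← Subgroup.zpowers_eq_closure]
  rfl

lemma evalHom_letterWord (γ : T ≃g T) (a : Γ ⊕ Bool) :
    evalHom Γ γ (letterWord a) = letterAct γ (toLetter a) := by
  rcases a with g | (_ | _)
  · rfl
  · simp only [letterWord, map_inv, evalHom_inr, toLetter, Sum.map_inr, id, letterAct]
  · simp only [letterWord, evalHom_inr, toLetter, Sum.map_inr, id, letterAct]

lemma spell_append (l l' : List (Γ ⊕ Bool)) : spell (l ++ l') = spell l * spell l' := by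
  simp [spell]

lemma spell_cons (a : Γ ⊕ Bool) (l : List (Γ ⊕ Bool)) :
    spell (a :: l) = letterWord a * spell l := by
  simp [spell]

lemma spell_surjective (w : Monoid.Coprod Γ (Multiplicative ℤ)) :
    ∃ l : List (Γ ⊕ Bool), spell l = w := by
  induction w using Monoid.Coprod.induction_on with
  | inl g => exact ⟨[.inl g], by simp [spell, letterWord]⟩
  | inr k =>
    have hnat : ∀ (b : Bool) (m : ℕ), spell (List.replicate m (.inr b : Γ ⊕ Bool)) =
        letterWord (.inr b) ^ m := by
      intro b m
      simp [spell]
    obtain ⟨m, hm⟩ := Int.eq_nat_or_neg (Multiplicative.toAdd k)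
    have hk : k = Multiplicative.ofAdd (1 : ℤ) ^ (Multiplicative.toAdd k) := by
      rw [← ofAdd_zsmul]
      simp
    rcases hm with hm | hm
    · refine ⟨List.replicate m (.inr true), ?_⟩
      rw [hnat, hk, hm, zpow_natCast, map_pow]
      rfl
    · refine ⟨List.replicate m (.inr false), ?_⟩
      rw [hnat, hk, hm, zpow_neg, zpow_natCast, map_inv, map_pow, ← inv_pow]
      rfl
  | mul a b ha hb =>
    obtain ⟨l, rfl⟩ := ha
    obtain ⟨l', rfl⟩ := hb
    exact ⟨l ++ l', spell_append l l'⟩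

lemma spell_eq_inl {l : List (Γ ⊕ Bool)} (h : ∀ a ∈ l, a.isRight = false) :
    ∃ g : Γ, spell l = Monoid.Coprod.inl g := by
  induction l with
  | nil => exact ⟨1, by simp [spell]⟩
  | cons a l ih =>
    obtain ⟨g, hg⟩ := ih fun b hb => h b (List.mem_cons_of_mem _ hb)
    rcases a with g' | b
    · exact ⟨g' * g, by rw [spell_cons, hg, map_mul]; rfl⟩
    · exact absurd (h _ List.mem_cons_self) (by simp)

lemma spell_pair_eq_one {l : List (Γ ⊕ Bool)} (hl : l.length = 2) {p q : ℕ}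
    (hp : p < l.length) (hq : q < l.length) (hpq : p ≠ q) (h1 : l[p] = .inr true)
    (h2 : l[q] = .inr false) : spell l = 1 := by
  obtain ⟨a, b, rfl⟩ := List.length_eq_two.1 hl
  have hp' : p < 2 := hp
  have hq' : q < 2 := hq
  interval_cases p <;> interval_cases q
  · exact absurd rfl hpq
  · simp only [List.getElem_cons_zero, List.getElem_cons_succ] at h1 h2
    simp [spell, h1, h2, letterWord]
  · simp only [List.getElem_cons_zero, List.getElem_cons_succ] at h1 h2
    simp [spell, h1, h2, letterWord]
  · exact absurd rfl hpq

/-- The cyclic word attached to a list of letters. -/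
def cyclicWord (l : List (Γ ⊕ Bool)) [NeZero l.length] (k : ZMod l.length) : (T ≃g T) ⊕ Bool :=
  toLetter (l[k.val]'(ZMod.val_lt k))

lemma isRight_toLetter (a : Γ ⊕ Bool) : (toLetter a).isRight = a.isRight := by
  rcases a with g | b <;> rfl

variable {l : List (Γ ⊕ Bool)} [NeZero l.length] {γ : T ≃g T}

lemma cyclicWord_natCast {k : ℕ} (hk : k < l.length) :
    cyclicWord l (k : ZMod l.length) = toLetter l[k] := by
  unfold cyclicWord
  congr 2
  exact ZMod.val_cast_of_lt hk

lemma evalHom_spell_drop {k : ℕ} (hk : k < l.length) (v : V) :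
    evalHom Γ γ (spell (l.drop k)) v =
      letterAct γ (cyclicWord l (k : ZMod l.length)) (evalHom Γ γ (spell (l.drop (k + 1))) v) := by
  rw [List.drop_eq_getElem_cons hk, spell_cons, map_mul, RelIso.mul_apply, evalHom_letterWord,
    cyclicWord_natCast hk]

lemma IsCyc.apply_natCast {x : ZMod l.length → V} (hx : IsCyc (cyclicWord l) γ x) {k : ℕ}
    (hk : k ≤ l.length) : evalHom Γ γ (spell (l.drop k)) (x 0) = x (k : ZMod l.length) := by
  induction hr : l.length - k generalizing k with
  | zero =>
    have : k = l.length := by omega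
    subst this
    simp [spell]
  | succ r ih =>
    rw [evalHom_spell_drop (by omega), ih (by omega) (by omega), Nat.cast_succ]
    exact hx _

lemma exists_isCyc_of_fixed {v : V} (hv : evalHom Γ γ (spell l) v = v) :
    ∃ x, IsCyc (cyclicWord l) γ x ∧ x 0 = v := by
  let x : ZMod l.length → V := fun k => evalHom Γ γ (spell (l.drop k.val)) v
  have hxk : ∀ k : ℕ, k ≤ l.length →
      x (k : ZMod l.length) = evalHom Γ γ (spell (l.drop k)) v := by
    intro k hk
    rcases hk.lt_or_eq with h | rfl
    · simp only [x, ZMod.val_cast_of_lt h]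
    · simp only [x, ZMod.natCast_self, ZMod.val_zero, List.drop_zero, List.drop_length, hv]
      simp [spell]
  refine ⟨x, fun j => ?_, ?_⟩
  · have hj := ZMod.natCast_zmod_val j
    have hlt := ZMod.val_lt j
    rw [← hj]
    unfold Holds
    rw [← Nat.cast_succ, hxk _ hlt, hxk _ hlt.le, ← evalHom_spell_drop hlt]
  · have := hxk 0 (Nat.zero_le _)
    rw [Nat.cast_zero] at this
    rw [this, List.drop_zero, hv]

lemma exists_ne_of_not_simple (hl : spell l ≠ 1) {x : ZMod l.length → V}
    (hx : IsCyc (cyclicWord l) γ x) (hns : ¬ SimpleTraj (cyclicWord l) x) :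
    ∃ i j, i ≠ j ∧ x i = x j := by
  unfold SimpleTraj at hns
  push Not at hns
  obtain ⟨i, j, hi, hj, h, hne⟩ := hns
  by_contra hcon
  push Not at hcon
  have htgt : tgt (cyclicWord l) i = tgt (cyclicWord l) j := by
    by_contra hc
    exact hcon _ _ hc h
  have hsrc : src (cyclicWord l) i = src (cyclicWord l) j := by
    by_contra hc
    refine hcon _ _ hc (γ.injective ?_)
    rw [(holds_iff_of_isRight hi γ x).1 (hx i), (holds_iff_of_isRight hj γ x).1 (hx j), h]
  have key : ∀ p q : ZMod l.length, cyclicWord l p = .inr true → cyclicWord l q = .inr false →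
      tgt (cyclicWord l) p = tgt (cyclicWord l) q →
      src (cyclicWord l) p = src (cyclicWord l) q → p ≠ q → False := by
    intro p q hp hq h1 h2 hpq
    simp only [tgt, src, hp, hq] at h1 h2
    have h3 : ((2 : ℕ) : ZMod l.length) = 0 := by
      have : q + 2 = q + 0 := by
        rw [add_zero]
        conv_rhs => rw [← h2, h1]
        ring
      exact_mod_cast add_left_cancel this
    rw [ZMod.natCast_eq_zero_iff] at h3
    have h0 := NeZero.ne l.length
    have hp' := ZMod.val_lt p
    have hq' := ZMod.val_lt q
    have hval : p.val ≠ q.val := fun h => hpq (ZMod.val_injective _ h)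
    have hlen : l.length = 2 := by
      have := Nat.le_of_dvd (by norm_num) h3
      omega
    refine hl (spell_pair_eq_one hlen hp' hq' hval ?_ ?_)
    · unfold cyclicWord at hp
      rcases hlp : l[p.val] with g | b
      · rw [hlp] at hp
        simp [toLetter] at hp
      · rw [hlp] at hp
        simpa [toLetter] using hp
    · unfold cyclicWord at hq
      rcases hlp : l[q.val] with g | b
      · rw [hlp] at hq
        simp [toLetter] at hq
      · rw [hlp] at hq
        simpa [toLetter] using hq
  rcases hi' : cyclicWord l i with g | (_ | _) <;> rcases hj' : cyclicWord l j with g' | (_ | _) <;>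
    rw [hi'] at hi <;> rw [hj'] at hj
  all_goals first
    | exact absurd hi Bool.false_ne_true
    | exact absurd hj Bool.false_ne_true
    | skip
  · simp only [src, hi', hj'] at hsrc
    exact hne hsrc
  · exact key j i hj' hi' htgt.symm hsrc.symm hne.symm
  · exact key i j hi' hj' htgt hsrc hne
  · simp only [tgt, hi', hj'] at htgt
    exact hne htgt

lemma finite_fixed_inter (hl : spell l ≠ 1)
    (ih : ∀ l' : List (Γ ⊕ Bool), l'.length < l.length → spell l' ≠ 1 →
      {v | evalHom Γ γ (spell l') v = v}.Finite) {i j : ℕ} (hij : i < j) (hj : j < l.length) :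
    {v | evalHom Γ γ (spell l) v = v ∧
      evalHom Γ γ (spell (l.drop i)) v = evalHom Γ γ (spell (l.drop j)) v}.Finite := by
  set a := l.take i with ha
  set b := (l.drop i).take (j - i) with hb
  set c := l.drop j with hc
  have hbc : l.drop i = b ++ c := by
    have := List.take_append_drop (j - i) (l.drop i)
    rw [List.drop_drop, Nat.add_sub_cancel' hij.le] at this
    exact this.symm
  have habc : l = a ++ (b ++ c) := by
    rw [← hbc, ha, List.take_append_drop]
  have hlb : b.length < l.length := by
    simp only [hb, List.length_take, List.length_drop]
    omega
  have hlac : (a ++ c).length < l.length := by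
    simp only [ha, hc, List.length_append, List.length_take, List.length_drop]
    omega
  rw [hbc]
  by_cases hb1 : spell b = 1
  · have hac : spell (a ++ c) = spell l := by
      conv_rhs => rw [habc]
      rw [spell_append, spell_append, spell_append, hb1, one_mul]
    refine (ih _ hlac (by rwa [hac])).subset fun v hv => ?_
    have := hv.1
    rwa [← hac] at this
  · refine Set.Finite.of_finite_image (f := evalHom Γ γ (spell c)) ?_
      (RelIso.injective _).injOn
    refine (ih b hlb hb1).subset ?_
    rintro _ ⟨v, hv, rfl⟩
    have := hv.2
    rwa [spell_append, map_mul, RelIso.mul_apply] at this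

lemma finite_not_simple (hl : spell l ≠ 1)
    (ih : ∀ l' : List (Γ ⊕ Bool), l'.length < l.length → spell l' ≠ 1 →
      {v | evalHom Γ γ (spell l') v = v}.Finite) :
    {x | IsCyc (cyclicWord l) γ x ∧ ¬ SimpleTraj (cyclicWord l) x}.Finite := by
  refine Set.Finite.of_finite_image (f := fun x => x 0) ?_ fun x hx z hz h => hx.1.eq hz.1 h
  have hfin : (⋃ p ∈ {p : ℕ × ℕ | p.1 < p.2 ∧ p.2 < l.length},
      {v | evalHom Γ γ (spell l) v = v ∧ evalHom Γ γ (spell (l.drop p.1)) v =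
        evalHom Γ γ (spell (l.drop p.2)) v}).Finite := by
    refine Set.Finite.biUnion ?_ fun p hp => finite_fixed_inter hl ih hp.1 hp.2
    refine ((Set.finite_lt_nat l.length).prod (Set.finite_lt_nat l.length)).subset ?_
    rintro ⟨a, b⟩ ⟨h1, h2⟩
    exact ⟨lt_trans h1 h2, h2⟩
  refine hfin.subset ?_
  rintro _ ⟨x, ⟨hx, hns⟩, rfl⟩
  have hfix : evalHom Γ γ (spell l) (x 0) = x 0 := by
    have := hx.apply_natCast (Nat.zero_le _)
    rwa [Nat.cast_zero, List.drop_zero] at this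
  have key : ∀ i j : ZMod l.length, i.val < j.val → x i = x j → x 0 ∈
      ⋃ p ∈ {p : ℕ × ℕ | p.1 < p.2 ∧ p.2 < l.length},
      {v | evalHom Γ γ (spell l) v = v ∧ evalHom Γ γ (spell (l.drop p.1)) v =
        evalHom Γ γ (spell (l.drop p.2)) v} := by
    intro i j hij h
    refine Set.mem_biUnion (x := (i.val, j.val)) ⟨hij, ZMod.val_lt j⟩ ⟨hfix, ?_⟩
    rw [hx.apply_natCast (ZMod.val_lt i).le, hx.apply_natCast (ZMod.val_lt j).le,
      ZMod.natCast_zmod_val, ZMod.natCast_zmod_val, h]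
  obtain ⟨i, j, hne, h⟩ := exists_ne_of_not_simple hl hx hns
  rcases lt_trichotomy i.val j.val with hlt | heq | hgt
  · exact key i j hlt h
  · exact absurd (ZMod.val_injective _ heq) hne
  · exact key j i hgt h.symm

end Words

section Main

variable {V : Type*} {T : SimpleGraph V} [MeasurableSpace (T ≃g T)] [BorelSpace (T ≃g T)]
  {μ : Measure (T ≃g T)} [μ.IsHaarMeasure] [T.LocallyFinite] {d : ℕ}
  {Γ : Subgroup (T ≃g T)} [Countable Γ]

theorem ae_finite_fixed (hT : T.IsTree) (hd : 3 ≤ d) (hreg : T.IsRegularOfDegree d)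
    (hμ : ∀ v : V, μ {a : T ≃g T | a v = v} = 1) (hΓ : ActsAlmostFreely T Γ) (N : ℕ) :
    ∀ l : List (Γ ⊕ Bool), l.length = N → spell l ≠ 1 →
      ∀ᵐ γ ∂μ, {v | evalHom Γ γ (spell l) v = v}.Finite := by
  induction N using Nat.strong_induction_on with
  | _ N ih =>
  intro l hN hl
  by_cases hgen : ∀ a ∈ l, a.isRight = false
  · obtain ⟨g, hg⟩ := spell_eq_inl hgen
    refine Filter.Eventually.of_forall fun γ => ?_
    rw [hg, evalHom_inl]
    refine hΓ g g.2 fun h => hl ?_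
    rw [hg, Subtype.ext (a2 := (1 : Γ)) h, map_one]
  push Not at hgen
  obtain ⟨a, ha, har⟩ := hgen
  obtain ⟨k, hk, rfl⟩ := List.mem_iff_getElem.1 ha
  have : NeZero l.length := ⟨by omega⟩
  have hih : ∀ᵐ γ ∂μ, ∀ l' : List (Γ ⊕ Bool), l'.length < l.length → spell l' ≠ 1 →
      {v | evalHom Γ γ (spell l') v = v}.Finite := by
    rw [ae_all_iff]
    intro l'
    by_cases h : l'.length < l.length ∧ spell l' ≠ 1
    · filter_upwards [ih _ (hN ▸ h.1) l' rfl h.2] with γ hγ _ _ using hγ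
    · exact Filter.Eventually.of_forall fun γ h1 h2 => absurd ⟨h1, h2⟩ h
  have hright : (cyclicWord l (k : ZMod l.length)).isRight := by
    rw [cyclicWord_natCast hk, isRight_toLetter]
    simpa using har
  filter_upwards [hih, ae_finite_isCyc hT hd hreg hμ (cyclicWord l) hright] with γ h1 h2
  refine ((h2 (finite_not_simple hl h1)).image fun x => x 0).subset fun v hv => ?_
  obtain ⟨x, hx, hx0⟩ := exists_isCyc_of_fixed hv
  exact ⟨x, hx, hx0⟩

end Main

end TreeAut

open TreeAut in
/-- For almost every `γ`, the group generated by `Γ` and `γ` acts almost freely and is the free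
product of `Γ` and the infinite cyclic group generated by `γ`. -/
theorem main_theorem {V : Type*} (T : SimpleGraph V) [T.LocallyFinite] (d : ℕ) (hd : 3 ≤ d)
    (hT : T.IsTree) (hreg : T.IsRegularOfDegree d)
    [MeasurableSpace (T ≃g T)] [BorelSpace (T ≃g T)]
    (μ : MeasureTheory.Measure (T ≃g T)) [μ.IsHaarMeasure]
    (hμ : ∀ v : V, μ {a : T ≃g T | a v = v} = 1)
    (Γ : Subgroup (T ≃g T)) [Countable Γ] (hΓ : TreeAut.ActsAlmostFreely T Γ) :
    ∀ᵐ γ ∂μ,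
      TreeAut.ActsAlmostFreely T (Subgroup.closure ((Γ : Set (T ≃g T)) ∪ {γ})) ∧
      ∃ e : Monoid.Coprod Γ (Multiplicative ℤ) ≃*
          Subgroup.closure ((Γ : Set (T ≃g T)) ∪ {γ}),
        (∀ g : Γ, (e (Monoid.Coprod.inl g) : T ≃g T) = g) ∧
        (e (Monoid.Coprod.inr (Multiplicative.ofAdd 1)) : T ≃g T) = γ := by
  have hinf : Infinite V := infinite_vertices hT hd hreg
  have hae : ∀ᵐ γ ∂μ, ∀ l : List (Γ ⊕ Bool), spell l ≠ 1 →
      {v | evalHom Γ γ (spell l) v = v}.Finite := by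
    rw [ae_all_iff]
    intro l
    by_cases h : spell l ≠ 1
    · filter_upwards [ae_finite_fixed hT hd hreg hμ hΓ _ l rfl h] with γ hγ _ using hγ
    · exact Filter.Eventually.of_forall fun γ h' => absurd h' h
  filter_upwards [hae] with γ hγ
  have hfix : ∀ w, w ≠ 1 → {v | evalHom Γ γ w v = v}.Finite := by
    intro w hw
    obtain ⟨l, rfl⟩ := spell_surjective w
    exact hγ l hw
  have hinj : Function.Injective (evalHom Γ γ) := by
    rw [injective_iff_map_eq_one]
    intro w hw
    by_contra hne
    have := hfix w hne
    rw [hw] at this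
    refine Set.infinite_univ (this.subset fun v _ => ?_)
    rfl
  have hrange := range_evalHom Γ γ
  refine ⟨?_, (MonoidHom.ofInjective hinj).trans (MulEquiv.subgroupCongr hrange), fun g => ?_, ?_⟩
  · intro g hg hne
    rw [← hrange] at hg
    obtain ⟨w, rfl⟩ := hg
    refine hfix w ?_
    rintro rfl
    exact hne (map_one _)
  · exact evalHom_inl γ g
  · exact evalHom_inr (Γ := Γ) γ
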